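/- Every uplifting cardinal κ has an ordinal-anticipating uplifting Laver function: there exists a function ℓ : κ → κ such that for every ordinal β there are unboundedly many inaccessible cardinals γ > κ admitting a function ℓ* : γ → γ with ⟨V_κ, ∈, ℓ⟩ ≺ ⟨V_γ, ∈, ℓ*⟩ and ℓ*(κ) = β. -/

import Mathlib

open FirstOrder Language

universe u

namespace Paper

/-- The language of set theory: a single binary relation symbol (membership).
We reuse `FirstOrder.Language.graph`, whose sole symbol is a binary relation. -/
abbrev LSet : FirstOrder.Language := FirstOrder.Language.graph

/-- The rank-initial segment `V_α` of the cumulative hierarchy, realized as the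
collection of ZF sets of rank less than `α`. -/
abbrev Vt (α : Ordinal) : Type 1 := {x : ZFSet // x.rank < α}

/-- `V_α` as a structure in the language of set theory, with the membership relation. -/
instance VtStructure (α : Ordinal) : LSet.Structure (Vt α) where
  funMap := fun f _ => f.elim
  RelMap := fun r x => match r with | .adj => (x 0).1 ∈ (x 1).1

/-- The universe of sets as a structure in the language of set theory. -/
instance ZFSetStructure : LSet.Structure ZFSet where
  funMap := fun f _ => f.elim
  RelMap := fun r x => match r with | .adj => x 0 ∈ x 1

/-- `V_α ≺ V_β`: the inclusion of `V_α` into `V_β` is an elementary embedding. -/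
def VElem (α β : Ordinal) : Prop :=
  ∃ e : Vt α ↪ₑ[LSet] Vt β, ∀ x : Vt α, (e x : ZFSet) = x

/-- An ordinal which is a cardinal. -/
def IsCardOrd (γ : Ordinal) : Prop := γ.card.ord = γ

/-- An ordinal which is a regular cardinal. -/
def IsRegularOrd (γ : Ordinal) : Prop := γ.card.IsRegular ∧ γ.card.ord = γ

/-- An ordinal which is an inaccessible cardinal (uncountable, regular, strong limit). -/
def IsInaccOrd (γ : Ordinal) : Prop := γ.card.IsInaccessible ∧ γ.card.ord = γ

/-- An inaccessible cardinal `κ` is uplifting if for every ordinal `θ` there is an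
inaccessible cardinal `γ ≥ θ` such that `V_κ ≺ V_γ` is a proper elementary extension. -/
def IsUplifting (κ : Ordinal) : Prop :=
  IsInaccOrd κ ∧ ∀ θ : Ordinal, ∃ γ : Ordinal, IsInaccOrd γ ∧ θ ≤ γ ∧ κ < γ ∧ VElem κ γ

/-- An inaccessible cardinal `κ` is pseudo uplifting if for every ordinal `θ` there is a
cardinal `γ ≥ θ` such that `V_κ ≺ V_γ` is a proper elementary extension. -/
def IsPseudoUplifting (κ : Ordinal) : Prop :=
  IsInaccOrd κ ∧ ∀ θ : Ordinal, ∃ γ : Ordinal, IsCardOrd γ ∧ θ ≤ γ ∧ κ < γ ∧ VElem κ γ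

/-- Function symbols for the language of set theory with an added unary function symbol. -/
inductive LFFun : ℕ → Type
  | fsym : LFFun 1

/-- Relation symbols for the language of set theory with an added unary function symbol. -/
inductive LFRel : ℕ → Type
  | mem : LFRel 2

/-- The language of set theory augmented by one unary function symbol. -/
def LF : FirstOrder.Language := ⟨LFFun, LFRel⟩

open Classical in
/-- The interpretation on `V_α` of the unary function symbol corresponding to an ordinal
function `f`: an element coding a von Neumann ordinal `β` is sent to the von Neumann
ordinal coding `f β` (when it lies in `V_α`), and the function is the identity off the
ordinals.  (A von Neumann ordinal is recovered from its rank.) -/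
noncomputable def fInterp (α : Ordinal) (f : Ordinal → Ordinal) (x : Vt α) : Vt α :=
  if h : x.1.IsOrdinal ∧ ∃ y : ZFSet, y.IsOrdinal ∧ y.rank = f x.1.rank ∧ y.rank < α then
    ⟨h.2.choose, h.2.choose_spec.2.2⟩
  else x

/-- The structure `⟨V_α, ∈, f⟩` for an ordinal function `f`. -/
noncomputable def LFStructure (α : Ordinal) (f : Ordinal → Ordinal) : LF.Structure (Vt α) where
  funMap := fun r x => match r with | .fsym => fInterp α f (x 0)
  RelMap := fun r x => match r with | .mem => (x 0).1 ∈ (x 1).1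

/-- `⟨V_α, ∈, f⟩ ≺ ⟨V_β, ∈, g⟩`: the inclusion of `V_α` into `V_β` is an elementary
embedding of the expanded structures. -/
def FVElem (α β : Ordinal) (f g : Ordinal → Ordinal) : Prop :=
  letI := LFStructure α f
  letI := LFStructure β g
  ∃ e : Vt α ↪ₑ[LF] Vt β, ∀ x : Vt α, (e x : ZFSet) = x

/-- `f : κ → κ` has the uplifting Menas property for `κ`: for every ordinal `θ` there is an
inaccessible cardinal `γ ≥ θ` with `κ < γ` and a function `f* : γ → γ` such that
`⟨V_κ, ∈, f⟩ ≺ ⟨V_γ, ∈, f*⟩` and `f*(κ) ≥ θ`. -/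
def MenasFor (f : Ordinal → Ordinal) (κ : Ordinal) : Prop :=
  (∀ δ < κ, f δ < κ) ∧
  ∀ θ : Ordinal, ∃ (γ : Ordinal) (g : Ordinal → Ordinal),
    IsInaccOrd γ ∧ θ ≤ γ ∧ κ < γ ∧ (∀ δ < γ, g δ < γ) ∧ FVElem κ γ f g ∧ θ ≤ g κ

/-- `ℓ : κ → κ` is an ordinal-anticipating uplifting Laver function for `κ`: for every
ordinal `β` there are unboundedly many inaccessible cardinals `γ > κ` admitting a function
`ℓ* : γ → γ` with `⟨V_κ, ∈, ℓ⟩ ≺ ⟨V_γ, ∈, ℓ*⟩` and `ℓ*(κ) = β`. -/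
def OrdLaverFor (ℓ : Ordinal → Ordinal) (κ : Ordinal) : Prop :=
  (∀ δ < κ, ℓ δ < κ) ∧
  ∀ (β θ : Ordinal), ∃ (γ : Ordinal) (g : Ordinal → Ordinal),
    IsInaccOrd γ ∧ θ ≤ γ ∧ κ < γ ∧ (∀ δ < γ, g δ < γ) ∧ FVElem κ γ ℓ g ∧ g κ = β

section Definability

/-- A formula with one distinguished group of variables can be universally quantified there. -/
theorem exists_formula_forall {L : FirstOrder.Language} {α β : Type*} (φ : L.Formula β)
    (g : β → α ⊕ Fin 1) :
    ∃ ψ : L.Formula α, ∀ (M : Type 1) [L.Structure M] (v : α → M),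
      ψ.Realize v ↔ ∀ a : M, φ.Realize (fun b => Sum.elim v (fun _ => a) (g b)) := by
  refine ⟨BoundedFormula.all (n := 0) (BoundedFormula.relabel (n := 1) (k := 0) g φ), ?_⟩
  intro M _ v
  rw [Formula.Realize, BoundedFormula.realize_all]
  refine forall_congr' fun a => ?_
  rw [BoundedFormula.realize_relabel, Formula.Realize]
  refine iff_of_eq ?_
  congr 1
  exact Subsingleton.elim _ _

/-- A family of predicates on assignments into the levels `V_o` is uniformly definable if a
single formula of set theory defines it in every `V_o` with `o` a limit ordinal. -/
def Dfn (P : ∀ o : Ordinal, (ℕ → Vt o) → Prop) : Prop :=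
  ∃ φ : LSet.Formula ℕ, ∀ o, Order.IsSuccLimit o → ∀ s : ℕ → Vt o, φ.Realize s ↔ P o s

variable {P Q : ∀ o : Ordinal, (ℕ → Vt o) → Prop}

theorem Dfn.congr (h : Dfn P) (H : ∀ o, Order.IsSuccLimit o → ∀ s, Q o s ↔ P o s) : Dfn Q := by
  obtain ⟨φ, hφ⟩ := h
  exact ⟨φ, fun o ho s => (hφ o ho s).trans (H o ho s).symm⟩

theorem Dfn.mem (i j : ℕ) : Dfn fun _ s => (s i).1 ∈ (s j).1 := by
  refine ⟨Relations.formula₂ Language.adj (Term.var i) (Term.var j), fun o _ s => ?_⟩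
  rw [Formula.realize_rel₂]
  rfl

theorem Dfn.eq (i j : ℕ) : Dfn fun _ s => s i = s j := by
  refine ⟨Term.equal (Term.var i) (Term.var j), fun o _ s => ?_⟩
  rw [Formula.realize_equal]
  rfl

theorem Dfn.imp (hP : Dfn P) (hQ : Dfn Q) : Dfn fun o s => P o s → Q o s := by
  obtain ⟨φ, hφ⟩ := hP
  obtain ⟨ψ, hψ⟩ := hQ
  exact ⟨φ.imp ψ, fun o ho s => by rw [Formula.realize_imp, hφ o ho, hψ o ho]⟩

theorem Dfn.not (hP : Dfn P) : Dfn fun o s => ¬ P o s := by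
  obtain ⟨φ, hφ⟩ := hP
  exact ⟨φ.not, fun o ho s => by rw [Formula.realize_not, hφ o ho]⟩

theorem Dfn.and (hP : Dfn P) (hQ : Dfn Q) : Dfn fun o s => P o s ∧ Q o s :=
  (hP.imp hQ.not).not.congr fun _ _ _ => by tauto

theorem Dfn.or (hP : Dfn P) (hQ : Dfn Q) : Dfn fun o s => P o s ∨ Q o s :=
  (hP.not.imp hQ).congr fun _ _ _ => by tauto

theorem Dfn.iff (hP : Dfn P) (hQ : Dfn Q) : Dfn fun o s => P o s ↔ Q o s :=
  ((hP.imp hQ).and (hQ.imp hP)).congr fun _ _ _ => by tauto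

theorem Dfn.all {P : ∀ o : Ordinal, (ℕ → Vt o) → Vt o → Prop}
    (h : Dfn fun o s => P o (fun n => s (n + 1)) (s 0)) : Dfn fun o s => ∀ a, P o s a := by
  obtain ⟨φ, hφ⟩ := h
  obtain ⟨ψ, hψ⟩ := exists_formula_forall φ (fun n : ℕ => n.casesOn (Sum.inr 0) Sum.inl)
  refine ⟨ψ, fun o ho s => (hψ _ s).trans (forall_congr' fun a => (hφ o ho _).trans ?_)⟩
  rfl

theorem Dfn.ex {P : ∀ o : Ordinal, (ℕ → Vt o) → Vt o → Prop}
    (h : Dfn fun o s => P o (fun n => s (n + 1)) (s 0)) : Dfn fun o s => ∃ a, P o s a :=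
  (Dfn.all (P := fun o s a => ¬ P o s a) h.not).not.congr fun _ _ _ => by simp

/-- Uniformly definable predicates are preserved by elementary inclusions. -/
theorem VElem.iff_of_dfn {α β : Ordinal} (h : VElem α β) (hα : Order.IsSuccLimit α)
    (hβ : Order.IsSuccLimit β) (hP : Dfn P) (s : ℕ → Vt α) (t : ℕ → Vt β)
    (hst : ∀ n, (t n).1 = (s n).1) : P α s ↔ P β t := by
  obtain ⟨e, he⟩ := h
  obtain ⟨φ, hφ⟩ := hP
  have : t = e ∘ s := funext fun n => Subtype.ext ((hst n).trans (he _).symm)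
  rw [← hφ α hα, ← hφ β hβ, this, e.map_formula]

end Definability

section InternalNotions

variable {o : Ordinal}

theorem rank_lt_of_mem_vt {x : ZFSet} {y : Vt o} (h : x ∈ y.1) : x.rank < o :=
  (ZFSet.rank_lt_of_mem h).trans y.2

theorem rank_singleton_lt (ho : Order.IsSuccLimit o) {x : ZFSet} (hx : x.rank < o) :
    ZFSet.rank {x} < o := by
  rw [ZFSet.rank_singleton]
  exact ho.succ_lt hx

theorem rank_doubleton_lt (ho : Order.IsSuccLimit o) {x y : ZFSet} (hx : x.rank < o)
    (hy : y.rank < o) : ZFSet.rank {x, y} < o := by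
  rw [ZFSet.rank_pair]
  exact max_lt (ho.succ_lt hx) (ho.succ_lt hy)

/-- `p` is the ordered pair of `x` and `y`. -/
def IsPair (p x y : Vt o) : Prop := p.1 = ZFSet.pair x.1 y.1

/-- The pair of `x` and `y` belongs to `f`. -/
def App (f x y : Vt o) : Prop := ZFSet.pair x.1 y.1 ∈ f.1

def IsOrd (x : Vt o) : Prop := x.1.IsOrdinal

theorem eq_singleton_iff_vt {x z : Vt o} : z.1 = {x.1} ↔ ∀ w : Vt o, w.1 ∈ z.1 ↔ w = x := by
  constructor
  · intro h w
    rw [h, ZFSet.mem_singleton, Subtype.ext_iff]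
  · intro h
    ext w
    rw [ZFSet.mem_singleton]
    constructor
    · intro hw
      exact congrArg Subtype.val ((h ⟨w, rank_lt_of_mem_vt hw⟩).1 hw)
    · rintro rfl
      exact (h x).2 rfl

theorem eq_doubleton_iff_vt {x y z : Vt o} :
    z.1 = {x.1, y.1} ↔ ∀ w : Vt o, w.1 ∈ z.1 ↔ w = x ∨ w = y := by
  constructor
  · intro h w
    rw [h, ZFSet.mem_pair, Subtype.ext_iff, Subtype.ext_iff]
  · intro h
    ext w
    rw [ZFSet.mem_pair]
    constructor
    · intro hw
      exact ((h ⟨w, rank_lt_of_mem_vt hw⟩).1 hw).imp (congrArg Subtype.val) (congrArg Subtype.val)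
    · rintro (rfl | rfl)
      · exact (h x).2 (.inl rfl)
      · exact (h y).2 (.inr rfl)

theorem isPair_iff (ho : Order.IsSuccLimit o) {p x y : Vt o} : IsPair p x y ↔
    ∀ z : Vt o, z.1 ∈ p.1 ↔
      (∀ w : Vt o, w.1 ∈ z.1 ↔ w = x) ∨ (∀ w : Vt o, w.1 ∈ z.1 ↔ w = x ∨ w = y) := by
  simp_rw [← eq_singleton_iff_vt, ← eq_doubleton_iff_vt]
  constructor
  · intro h z
    rw [show p.1 = ZFSet.pair x.1 y.1 from h, ZFSet.pair, ZFSet.mem_pair]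
  · intro h
    refine ZFSet.ext fun z => ?_
    rw [ZFSet.pair, ZFSet.mem_pair]
    constructor
    · intro hz
      exact (h ⟨z, rank_lt_of_mem_vt hz⟩).1 hz
    · rintro (rfl | rfl)
      · exact (h ⟨_, rank_singleton_lt ho x.2⟩).2 (.inl rfl)
      · exact (h ⟨_, rank_doubleton_lt ho x.2 y.2⟩).2 (.inr rfl)

theorem Dfn.isPair (i j k : ℕ) : Dfn fun _ s => IsPair (s i) (s j) (s k) := by
  refine Dfn.congr ?_ fun o ho s => isPair_iff ho
  repeat' first | exact Dfn.mem _ _ | exact Dfn.eq _ _ | apply Dfn.all | apply Dfn.iff | apply Dfn.or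

theorem Dfn.app (i j k : ℕ) : Dfn fun _ s => App (s i) (s j) (s k) := by
  refine Dfn.congr (P := fun o s => ∃ p : Vt o, p.1 ∈ (s i).1 ∧ IsPair p (s j) (s k)) ?_ ?_
  · exact .ex (.and (.mem _ _) (.isPair _ _ _))
  · intro o ho s
    constructor
    · intro h
      exact ⟨⟨_, rank_lt_of_mem_vt h⟩, h, rfl⟩
    · rintro ⟨p, hp, h⟩
      rw [show p.1 = _ from h] at hp
      exact hp

theorem Dfn.isOrd (i : ℕ) : Dfn fun _ s => IsOrd (s i) := by
  refine Dfn.congr (P := fun o s => (∀ y : Vt o, y.1 ∈ (s i).1 → ∀ z : Vt o, z.1 ∈ y.1 →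
    z.1 ∈ (s i).1) ∧ ∀ y : Vt o, y.1 ∈ (s i).1 → ∀ z : Vt o, z.1 ∈ y.1 → ∀ w : Vt o, w.1 ∈ z.1 →
      w.1 ∈ y.1) ?_ ?_
  · repeat' first | exact Dfn.mem _ _ | apply Dfn.all | apply Dfn.and | apply Dfn.imp
  · intro o ho s
    constructor
    · intro h
      exact ⟨fun y hy z hz => h.mem_trans hz hy, fun y hy z hz w hw => (h.mem hy).mem_trans hw hz⟩
    · rintro ⟨h₁, h₂⟩
      refine ⟨fun y hy z hz => ?_, fun {w z y} hw hz hy => ?_⟩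
      · have hy' := rank_lt_of_mem_vt hy
        exact h₁ ⟨y, hy'⟩ hy ⟨z, rank_lt_of_mem_vt (y := ⟨y, hy'⟩) hz⟩ hz
      · have hy' := rank_lt_of_mem_vt hy
        have hz' := rank_lt_of_mem_vt (y := ⟨y, hy'⟩) hz
        exact h₂ ⟨y, hy'⟩ hy ⟨z, hz'⟩ hz ⟨w, rank_lt_of_mem_vt (y := ⟨z, hz'⟩) hw⟩ hw

/-- `M` satisfies, from the point of view of `V_o`, the closure properties of an uncountable
Grothendieck universe. -/
def Univ (M : Vt o) : Prop :=
  (∀ x : Vt o, x.1 ∈ M.1 → ∀ y : Vt o, y.1 ∈ x.1 → y.1 ∈ M.1) ∧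
  (∀ x : Vt o, x.1 ∈ M.1 → ∃ p : Vt o, p.1 ∈ M.1 ∧
    ∀ z : Vt o, (∀ w : Vt o, w.1 ∈ z.1 → w.1 ∈ x.1) → z.1 ∈ p.1) ∧
  (∀ x : Vt o, x.1 ∈ M.1 → ∀ f : Vt o,
    (∀ i y z : Vt o, App f i y → App f i z → y = z) →
    ∃ u : Vt o, u.1 ∈ M.1 ∧ ∀ i : Vt o, i.1 ∈ x.1 → ∀ y : Vt o, y.1 ∈ M.1 → App f i y →
      ∀ w : Vt o, w.1 ∈ y.1 → w.1 ∈ u.1) ∧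
  (∃ x : Vt o, x.1 ∈ M.1 ∧ (∃ y : Vt o, y.1 ∈ x.1) ∧
    ∀ y : Vt o, y.1 ∈ x.1 → ∃ z : Vt o, z.1 ∈ x.1 ∧ y.1 ∈ z.1)

theorem Dfn.univ (i : ℕ) : Dfn fun _ s => Univ (s i) := by
  unfold Univ
  repeat'
    first
      | exact Dfn.mem _ _
      | exact Dfn.eq _ _
      | exact Dfn.app _ _ _
      | apply Dfn.all
      | apply Dfn.ex
      | apply Dfn.and
      | apply Dfn.imp

/-- `σ` is a function from `N` to `M`, viewed as an assignment of variables indexed by `N`. -/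
def Assign (N M σ : Vt o) : Prop :=
  (∀ p : Vt o, p.1 ∈ σ.1 → ∃ i : Vt o, i.1 ∈ N.1 ∧ ∃ a : Vt o, a.1 ∈ M.1 ∧ IsPair p i a) ∧
  (∀ i : Vt o, i.1 ∈ N.1 → ∃ a : Vt o, App σ i a) ∧
  (∀ i a b : Vt o, App σ i a → App σ i b → a = b)

theorem Dfn.assign (i j k : ℕ) : Dfn fun _ s => Assign (s i) (s j) (s k) := by
  unfold Assign
  repeat'
    first
      | exact Dfn.mem _ _
      | exact Dfn.eq _ _
      | exact Dfn.app _ _ _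
      | exact Dfn.isPair _ _ _
      | apply Dfn.all
      | apply Dfn.ex
      | apply Dfn.and
      | apply Dfn.imp

/-- The assignments `σ` and `τ` agree except possibly at `i`. -/
def Agree (N i σ τ : Vt o) : Prop :=
  ∀ j : Vt o, j.1 ∈ N.1 → ¬ j = i → ∀ a : Vt o, App σ j a ↔ App τ j a

theorem Dfn.agree (i j k l : ℕ) : Dfn fun _ s => Agree (s i) (s j) (s k) (s l) := by
  unfold Agree
  repeat'
    first
      | exact Dfn.mem _ _
      | exact Dfn.eq _ _
      | exact Dfn.app _ _ _
      | apply Dfn.all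
      | apply Dfn.iff
      | apply Dfn.not
      | apply Dfn.imp

/-- Elementarity of `N` in `M`, expressed by the existence of a family of sets of assignments
that contains the atomic ones, is closed under the logical operations, and passes the
Tarski-Vaught test. -/
def ElemIn (N M : Vt o) : Prop :=
  ∃ D : Vt o,
    (∃ X : Vt o, X.1 ∈ D.1 ∧ ∀ σ : Vt o, Assign N M σ → ¬ σ.1 ∈ X.1) ∧
    (∀ i : Vt o, i.1 ∈ N.1 → ∀ j : Vt o, j.1 ∈ N.1 → ∃ X : Vt o, X.1 ∈ D.1 ∧
      ∀ σ : Vt o, Assign N M σ →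
        (σ.1 ∈ X.1 ↔ ∃ a b : Vt o, App σ i a ∧ App σ j b ∧ a.1 ∈ b.1)) ∧
    (∀ i : Vt o, i.1 ∈ N.1 → ∀ j : Vt o, j.1 ∈ N.1 → ∃ X : Vt o, X.1 ∈ D.1 ∧
      ∀ σ : Vt o, Assign N M σ → (σ.1 ∈ X.1 ↔ ∃ a : Vt o, App σ i a ∧ App σ j a)) ∧
    (∀ X : Vt o, X.1 ∈ D.1 → ∀ Y : Vt o, Y.1 ∈ D.1 → ∃ Z : Vt o, Z.1 ∈ D.1 ∧
      ∀ σ : Vt o, Assign N M σ → (σ.1 ∈ Z.1 ↔ (σ.1 ∈ X.1 → σ.1 ∈ Y.1))) ∧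
    (∀ X : Vt o, X.1 ∈ D.1 → ∀ i : Vt o, i.1 ∈ N.1 → ∃ Z : Vt o, Z.1 ∈ D.1 ∧
      ∀ σ : Vt o, Assign N M σ →
        (σ.1 ∈ Z.1 ↔ ∀ τ : Vt o, Assign N M τ → Agree N i σ τ → τ.1 ∈ X.1)) ∧
    (∀ X : Vt o, X.1 ∈ D.1 → ∀ i : Vt o, i.1 ∈ N.1 → ∀ σ : Vt o, Assign N N σ →
      (∃ τ : Vt o, Assign N M τ ∧ Agree N i σ τ ∧ τ.1 ∈ X.1) →
        ∃ τ : Vt o, Assign N N τ ∧ Agree N i σ τ ∧ τ.1 ∈ X.1)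

theorem Dfn.elemIn (i j : ℕ) : Dfn fun _ s => ElemIn (s i) (s j) := by
  unfold ElemIn
  repeat'
    first
      | exact Dfn.mem _ _
      | exact Dfn.app _ _ _
      | exact Dfn.assign _ _ _
      | exact Dfn.agree _ _ _ _
      | apply Dfn.all
      | apply Dfn.ex
      | apply Dfn.and
      | apply Dfn.iff
      | apply Dfn.not
      | apply Dfn.imp

/-- `M` is a universe that elementarily extends a universe of height `d`. -/
def UnivExt (d M : Vt o) : Prop :=
  ∃ N : Vt o, N.1 ∈ M.1 ∧ Univ N ∧ (∀ x : Vt o, x.1 ∈ d.1 → x.1 ∈ N.1) ∧ ¬ d.1 ∈ N.1 ∧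
    Univ M ∧ ElemIn N M

theorem Dfn.univExt (i j : ℕ) : Dfn fun _ s => UnivExt (s i) (s j) := by
  unfold UnivExt
  repeat'
    first
      | exact Dfn.mem _ _
      | exact Dfn.univ _
      | exact Dfn.elemIn _ _
      | apply Dfn.all
      | apply Dfn.ex
      | apply Dfn.and
      | apply Dfn.not
      | apply Dfn.imp

/-- The ordinal `b ≤ t` has not been hit, according to `H`, at any level above `t`. -/
def Cand (H : Vt o → Vt o → Prop) (t b : Vt o) : Prop :=
  IsOrd t ∧ IsOrd b ∧ (∀ x : Vt o, x.1 ∈ b.1 → x.1 ∈ t.1) ∧ ∀ m : Vt o, H m b → ¬ t.1 ∈ m.1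

/-- `b` is the second entry of the lexicographically least candidate pair, or `∅` if no
candidate pair exists. -/
def LeastCand (H : Vt o → Vt o → Prop) (b : Vt o) : Prop :=
  (∃ t : Vt o, Cand H t b ∧ (∀ t' : Vt o, t'.1 ∈ t.1 → ∀ b' : Vt o, ¬ Cand H t' b') ∧
    ∀ b' : Vt o, b'.1 ∈ b.1 → ¬ Cand H t b') ∨
  (∀ x : Vt o, ¬ x.1 ∈ b.1) ∧ ∀ t b' : Vt o, ¬ Cand H t b'

theorem Dfn.cand {H : ∀ o : Ordinal, (ℕ → Vt o) → Vt o → Vt o → Prop}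
    (hH : ∀ (ρ : ℕ → ℕ) (i j : ℕ), Dfn fun o s => H o (fun n => s (ρ n)) (s i) (s j))
    (ρ : ℕ → ℕ) (i j : ℕ) :
    Dfn fun o s => Cand (H o fun n => s (ρ n)) (s i) (s j) := by
  unfold Cand
  refine .and (.isOrd _) (.and (.isOrd _) (.and (.all (.imp (.mem _ _) (.mem _ _)))
    (.all (.imp ?_ (.not (.mem _ _))))))
  exact hH (fun n => ρ n + 1) 0 (j + 1)

theorem Dfn.leastCand {H : ∀ o : Ordinal, (ℕ → Vt o) → Vt o → Vt o → Prop}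
    (hH : ∀ (ρ : ℕ → ℕ) (i j : ℕ), Dfn fun o s => H o (fun n => s (ρ n)) (s i) (s j))
    (ρ : ℕ → ℕ) (i : ℕ) :
    Dfn fun o s => LeastCand (H o fun n => s (ρ n)) (s i) := by
  unfold LeastCand
  refine .or (.ex (.and ?_ (.and (.all (.imp (.mem _ _) (.all (.not ?_))))
    (.all (.imp (.mem _ _) (.not ?_)))))) (.and (.all (.not (.mem _ _)))
    (.all (.all (.not ?_))))
  · exact Dfn.cand hH (fun n => ρ n + 1) 0 (i + 1)
  · exact Dfn.cand hH (fun n => ρ n + 1 + 1 + 1) 1 0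
  · exact Dfn.cand hH (fun n => ρ n + 1 + 1) 1 0
  · exact Dfn.cand hH (fun n => ρ n + 1 + 1) 1 0

/-- `f` is an attempt at the recursion assigning to each universe extending the one of height
`d` its least candidate, given the values at smaller universes. -/
def Attempt (d f : Vt o) : Prop :=
  ∀ m b : Vt o, App f m b → UnivExt d m ∧
    LeastCand (fun m' b' : Vt o => m'.1 ∈ m.1 ∧ App f m' b') b ∧
    ∀ m' : Vt o, m'.1 ∈ m.1 → UnivExt d m' → ∃ b' : Vt o, App f m' b'

theorem Dfn.attempt (i j : ℕ) : Dfn fun _ s => Attempt (s i) (s j) := by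
  unfold Attempt
  refine .all (.all (.imp (.app _ _ _) (.and (.univExt _ _) (.and ?_
    (.all (.imp (.mem _ _) (.imp (.univExt _ _) (.ex (.app _ _ _)))))))))
  exact Dfn.leastCand (H := fun o s m' b' => m'.1 ∈ (s 0).1 ∧ App (s 1) m' b')
    (fun ρ i j => .and (.mem _ _) (.app _ _ _))
    (fun n => if n = 0 then 1 else j + 1 + 1) 0

/-- Some attempt sends `m` to `b`. -/
def AttemptVal (d m b : Vt o) : Prop := ∃ f : Vt o, Attempt d f ∧ App f m b

theorem Dfn.attemptVal (i j k : ℕ) : Dfn fun _ s => AttemptVal (s i) (s j) (s k) := by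
  unfold AttemptVal
  exact .ex (.and (.attempt _ _) (.app _ _ _))

/-- The graph, in `V_o`, of the anticipating function. -/
def LaverGraph (x y : Vt o) : Prop :=
  (IsOrd x ∧ LeastCand (AttemptVal x) y) ∨ (¬ IsOrd x ∧ y = x)

theorem Dfn.laverGraph (i j : ℕ) : Dfn fun _ s => LaverGraph (s i) (s j) := by
  unfold LaverGraph
  refine .or (.and (.isOrd _) ?_) (.and (.not (.isOrd _)) (.eq _ _))
  exact Dfn.leastCand (H := fun o s => AttemptVal (s 0)) (fun ρ i j => .attemptVal _ _ _)
    (fun _ => i) j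

end InternalNotions

section Universes

open Cardinal ZFSet

variable {o γ δ : Ordinal}

/-- The graph of the restriction of `F` to the set `x`. -/
noncomputable def graphOn (x : ZFSet.{0}) (F : ZFSet.{0} → ZFSet.{0}) : ZFSet.{0} :=
  ZFSet.range fun i : x => pair i.1 (F i.1)

theorem mem_graphOn {x p : ZFSet} {F : ZFSet → ZFSet} :
    p ∈ graphOn x F ↔ ∃ i ∈ x, p = pair i (F i) := by
  rw [graphOn, ZFSet.mem_range]
  constructor
  · rintro ⟨i, rfl⟩
    exact ⟨i.1, i.2, rfl⟩
  · rintro ⟨i, hi, rfl⟩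
    exact ⟨⟨i, hi⟩, rfl⟩

theorem pair_mem_graphOn {x i a : ZFSet} {F : ZFSet → ZFSet} :
    pair i a ∈ graphOn x F ↔ i ∈ x ∧ a = F i := by
  rw [mem_graphOn]
  constructor
  · rintro ⟨j, hj, h⟩
    obtain ⟨rfl, rfl⟩ := pair_inj.1 h
    exact ⟨hj, rfl⟩
  · rintro ⟨hi, rfl⟩
    exact ⟨i, hi, rfl⟩

theorem rank_pair_le {x y : ZFSet} (hx : x.rank < γ) (hy : y.rank < γ) :
    (pair x y).rank ≤ Order.succ γ := by
  rw [pair, ZFSet.rank_pair, ZFSet.rank_pair, ZFSet.rank_singleton]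
  refine max_le (Order.succ_le_succ ?_) (Order.succ_le_succ (max_le ?_ ?_)) <;>
    exact Order.succ_le_of_lt ‹_›

theorem rank_graphOn_lt (ho : Order.IsSuccLimit o) (hγ : γ < o) {x : ZFSet} {F : ZFSet → ZFSet}
    (hx : x.rank ≤ γ) (hF : ∀ i ∈ x, (F i).rank < γ) : (graphOn x F).rank < o := by
  refine lt_of_le_of_lt ?_ (ho.succ_lt (ho.succ_lt hγ))
  rw [ZFSet.rank_le_iff]
  intro p hp
  obtain ⟨i, hi, rfl⟩ := mem_graphOn.1 hp
  exact Order.lt_succ_of_le (rank_pair_le ((rank_lt_of_mem hi).trans_le hx) (hF i hi))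

theorem IsInaccOrd.isSuccLimit (h : IsInaccOrd γ) : Order.IsSuccLimit γ := by
  rw [← h.2]
  exact isSuccLimit_ord h.1.aleph0_lt.le

theorem IsInaccOrd.card_lt (h : IsInaccOrd γ) {x : ZFSet} (hx : x.rank < γ) :
    x.card < γ.card := by
  refine (card_mono (subset_vonNeumann_self x)).trans_lt ?_
  rw [card_vonNeumann, ← h.1.preBeth_ord, h.2]
  exact preBeth_strictMono hx

theorem IsInaccOrd.exists_bound (h : IsInaccOrd γ) {x : ZFSet.{0}} (hx : x.rank < γ)
    {F : ZFSet → Ordinal} (hF : ∀ i ∈ x, F i < γ) : ∃ a < γ, ∀ i ∈ x, F i ≤ a := by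
  let f : Shrink.{0} x → Ordinal := fun i => F ((equivShrink x).symm i).1
  refine ⟨⨆ i, f i, ?_, fun i hi => ?_⟩
  · rw [← h.2]
    refine Ordinal.iSup_lt_of_lt_cof ?_ fun i => ?_
    · rw [h.1.isRegular.cof_ord]
      exact h.card_lt hx
    rw [h.2]
    exact hF _ ((equivShrink x).symm i).2
  · have := Ordinal.le_iSup f (equivShrink x ⟨i, hi⟩)
    simpa [f] using this

theorem univ_vonNeumann (ho : Order.IsSuccLimit o) (h : IsInaccOrd γ) {M : Vt o}
    (hM : M.1 = V_ γ) : Univ M := by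
  have hγ : γ < o := by simpa [hM] using M.2
  refine ⟨fun x hx y hy => ?_, fun x hx => ?_, fun x hx f hf => ?_, ?_⟩
  · rw [hM] at hx ⊢
    exact isTransitive_vonNeumann γ _ hx hy
  · rw [hM, mem_vonNeumann] at hx
    have hp : (powerset x.1).rank < γ := by
      rw [rank_powerset]
      exact h.isSuccLimit.succ_lt hx
    refine ⟨⟨powerset x.1, hp.trans hγ⟩, ?_, fun z hz => ?_⟩
    · rwa [hM, mem_vonNeumann]
    · rw [mem_powerset]
      exact fun w hw => hz ⟨w, rank_lt_of_mem_vt hw⟩ hw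
  · rw [hM, mem_vonNeumann] at hx
    classical
    let F : ZFSet → Ordinal := fun i =>
      if hi : ∃ y : ZFSet, y.rank < γ ∧ pair i y ∈ f.1 then hi.choose.rank else 0
    obtain ⟨a, ha, hFa⟩ := h.exists_bound hx (F := F) fun i _ => by
      unfold F
      split_ifs with hi
      · exact hi.choose_spec.1
      · exact h.isSuccLimit.bot_lt
    refine ⟨⟨V_ a, by simpa using ha.trans hγ⟩, ?_, fun i hi y hy hiy w hw => ?_⟩
    · rw [hM]
      exact vonNeumann_mem_of_lt ha
    · rw [hM, mem_vonNeumann] at hy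
      rw [mem_vonNeumann]
      have hex : ∃ y : ZFSet, y.rank < γ ∧ pair i.1 y ∈ f.1 := ⟨y.1, hy, hiy⟩
      have hy' : y.1 = hex.choose := congrArg Subtype.val
        (hf i y ⟨hex.choose, hex.choose_spec.1.trans hγ⟩ hiy hex.choose_spec.2)
      have := hFa i.1 hi
      unfold F at this
      rw [dif_pos hex, ← hy'] at this
      exact (rank_lt_of_mem hw).trans_le this
  · have hω : Ordinal.omega0 < γ := by
      rw [← h.2, Cardinal.lt_ord, Ordinal.card_omega0]
      exact h.1.aleph0_lt
    refine ⟨⟨V_ Ordinal.omega0, by simpa using hω.trans hγ⟩, ?_, ?_, fun y hy => ?_⟩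
    · rw [hM]
      exact vonNeumann_mem_of_lt hω
    · refine ⟨⟨∅, by simpa using ho.bot_lt⟩, ?_⟩
      rw [mem_vonNeumann]
      simp
    · rw [mem_vonNeumann] at hy
      refine ⟨⟨{y.1}, rank_singleton_lt ho y.2⟩, ?_, ?_⟩
      · rw [mem_vonNeumann, rank_singleton]
        exact Ordinal.isSuccLimit_omega0.succ_lt hy
      · simp

theorem Univ.exists_forall_subset (ho : Order.IsSuccLimit o) {M : Vt o} (h : Univ M) {x : ZFSet}
    (hx : x ∈ M.1) {F : ZFSet → ZFSet} (hF : ∀ i ∈ x, F i ∈ M.1) :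
    ∃ u ∈ M.1, ∀ i ∈ x, F i ⊆ u := by
  have hxM := rank_lt_of_mem hx
  have hxo := rank_lt_of_mem_vt hx
  obtain ⟨u, hu, H⟩ := h.2.2.1 ⟨x, hxo⟩ hx ⟨graphOn x F,
    rank_graphOn_lt ho M.2 hxM.le fun i hi => rank_lt_of_mem (hF i hi)⟩
    fun i y z hy hz => Subtype.ext
      ((pair_mem_graphOn.1 hy).2.trans (pair_mem_graphOn.1 hz).2.symm)
  refine ⟨u.1, hu, fun i hi w hw => ?_⟩
  have hFi := rank_lt_of_mem_vt (hF i hi)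
  exact H ⟨i, (rank_lt_of_mem hi).trans hxo⟩ hi ⟨F i, hFi⟩ (hF i hi)
    (pair_mem_graphOn.2 ⟨hi, rfl⟩) ⟨w, (rank_lt_of_mem hw).trans hFi⟩ hw

theorem Univ.exists_forall_rank_le (ho : Order.IsSuccLimit o) {M : Vt o} (h : Univ M)
    (y : ZFSet) (hy : y ∈ M.1) : ∃ u ∈ M.1, ∀ x : ZFSet, x.rank ≤ y.rank → x ∈ u := by
  induction y using ZFSet.inductionOn with
  | _ y ih =>
    have hyo := rank_lt_of_mem_vt hy
    have hmem : ∀ i ∈ y, i ∈ M.1 := fun i hi =>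
      h.1 ⟨y, hyo⟩ hy ⟨i, (rank_lt_of_mem hi).trans hyo⟩ hi
    choose! U hU hU' using fun i hi => ih i hi (hmem i hi)
    obtain ⟨u, hu, huU⟩ := h.exists_forall_subset ho hy hU
    obtain ⟨p, hp, hp'⟩ := h.2.1 ⟨u, rank_lt_of_mem_vt hu⟩ hu
    refine ⟨p.1, hp, fun x hx => hp' ⟨x, hx.trans_lt hyo⟩ fun w hw => ?_⟩
    obtain ⟨i, hi, hwi⟩ := ZFSet.lt_rank_iff.1 ((rank_lt_of_mem hw).trans_le hx)
    exact huU i hi (hU' i hi _ hwi)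

theorem Univ.eq_vonNeumann (ho : Order.IsSuccLimit o) {M : Vt o} (h : Univ M) :
    M.1 = V_ M.1.rank := by
  refine ZFSet.ext fun x => ?_
  rw [mem_vonNeumann]
  refine ⟨rank_lt_of_mem, fun hx => ?_⟩
  obtain ⟨y, hy, hxy⟩ := ZFSet.lt_rank_iff.1 hx
  obtain ⟨u, hu, hu'⟩ := h.exists_forall_rank_le ho y hy
  exact h.1 ⟨u, rank_lt_of_mem_vt hu⟩ hu ⟨x, hx.trans M.2⟩ (hu' x hxy)

theorem Univ.exists_bound (ho : Order.IsSuccLimit o) {M : Vt o} (h : Univ M) {x : ZFSet}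
    (hx : x.rank < M.1.rank) {ι : Type} (hι : #ι ≤ x.card) {f : ι → Ordinal}
    (hf : ∀ i, f i < M.1.rank) : ∃ a < M.1.rank, ∀ i, f i ≤ a := by
  obtain ⟨e⟩ := hι
  have hmem : ∀ {y : ZFSet}, y.rank < M.1.rank → y ∈ M.1 := fun {y} hy => by
    rw [h.eq_vonNeumann ho, mem_vonNeumann]
    exact hy
  classical
  obtain ⟨u, hu, hu'⟩ := h.exists_forall_subset ho (hmem hx)
    (F := fun s => if hs : ∃ i, ((equivShrink x).symm (e i)).1 = s then
      (f hs.choose).toZFSet else ∅) fun s hs => by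
        apply hmem
        split_ifs with hi
        · rw [Ordinal.rank_toZFSet]
          exact hf _
        · rw [rank_empty]
          exact zero_le.trans_lt hx
  refine ⟨u.rank, rank_lt_of_mem hu, fun i => ?_⟩
  have hex : ∃ j, ((equivShrink x).symm (e j)).1 = ((equivShrink x).symm (e i)).1 := ⟨i, rfl⟩
  have := hu' _ ((equivShrink x).symm (e i)).2
  rw [dif_pos hex] at this
  have hi : hex.choose = i := by
    have := hex.choose_spec
    exact e.injective ((equivShrink x).symm.injective (Subtype.ext this))
  rw [hi] at this
  simpa using rank_mono this

theorem Univ.isInaccOrd (ho : Order.IsSuccLimit o) {M : Vt o} (h : Univ M) :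
    IsInaccOrd M.1.rank := by
  set γ := M.1.rank with hγ
  have hM : M.1 = V_ γ := h.eq_vonNeumann ho
  have hlim : ∀ a < γ, Order.succ a < γ := fun a ha => by
    obtain ⟨p, hp, hp'⟩ := h.2.1 ⟨V_ a, by simpa using ha.trans M.2⟩
      (by rw [hM]; exact vonNeumann_mem_of_lt ha)
    have : V_ a ∈ p.1 := hp' ⟨V_ a, by simpa using ha.trans M.2⟩ fun _ => id
    have h₁ := rank_lt_of_mem this
    rw [rank_vonNeumann] at h₁
    exact (Order.succ_le_of_lt h₁).trans_lt (rank_lt_of_mem hp)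
  have hsmall : ∀ x : ZFSet, x.rank < γ → x.card < γ.card := fun x hx => by
    by_contra hc
    obtain ⟨a, ha, ha'⟩ := h.exists_bound ho hx (ι := γ.ToType)
      (by rw [Cardinal.mk_toType]; exact not_lt.1 hc)
      (f := fun i => (Ordinal.ToType.mk.symm i).1) fun i => (Ordinal.ToType.mk.symm i).2
    have := ha' (Ordinal.ToType.mk ⟨Order.succ a, hlim a ha⟩)
    simp at this
  have hord : γ.card.ord = γ := by
    refine (Cardinal.ord_card_le γ).eq_of_not_lt fun hlt => ?_
    have := hsmall γ.card.ord.toZFSet (by simpa using hlt)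
    simp at this
  have hω : Ordinal.omega0 < γ := by
    obtain ⟨x, hx, ⟨y, hy⟩, hx'⟩ := h.2.2.2
    refine lt_of_le_of_lt ?_ (rank_lt_of_mem hx)
    rw [Ordinal.omega0_le]
    intro n
    suffices ∃ z : Vt o, z.1 ∈ x.1 ∧ (n : Ordinal) ≤ z.1.rank by
      obtain ⟨z, hz, hn⟩ := this
      exact hn.trans (rank_lt_of_mem hz).le
    induction n with
    | zero => exact ⟨y, hy, by simp⟩
    | succ n ih =>
      obtain ⟨z, hz, hn⟩ := ih
      obtain ⟨w, hw, hzw⟩ := hx' z hz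
      refine ⟨w, hw, ?_⟩
      rw [Nat.cast_succ, ← Order.succ_eq_add_one]
      exact Order.succ_le_of_lt (hn.trans_lt (rank_lt_of_mem hzw))
  refine ⟨⟨?_, ?_, ?_⟩, hord⟩
  · rwa [← Ordinal.card_omega0, ← Cardinal.lt_ord, hord]
  · rw [hord]
    by_contra hc
    obtain ⟨S, hS, hScard⟩ := Order.exists_cof_eq γ.ToType
    rw [Ordinal.cof_toType] at hScard
    obtain ⟨a, ha, ha'⟩ := h.exists_bound ho (x := γ.cof.ord.toZFSet)
      (by rw [Ordinal.rank_toZFSet, ← hγ, ← hord, Cardinal.ord_lt_ord]; simpa [hord] using hc)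
      (ι := S) (by simp [hScard]) (f := fun i => (Ordinal.ToType.mk.symm i.1).1)
      fun i => (Ordinal.ToType.mk.symm i.1).2
    obtain ⟨b, hb, hab⟩ := hS (Ordinal.ToType.mk ⟨Order.succ a, hlim a ha⟩)
    rw [← OrderIso.le_symm_apply] at hab
    exact (Order.lt_succ a).not_ge (le_trans hab (ha' ⟨b, hb⟩))
  · intro c hc
    have hc' : c.ord < γ := by
      rw [← hord]
      exact Cardinal.ord_lt_ord.2 hc
    have := hsmall (powerset c.ord.toZFSet) (by
      rw [rank_powerset, Ordinal.rank_toZFSet]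
      exact hlim _ hc')
    simpa using this

theorem univ_iff (ho : Order.IsSuccLimit o) {M : Vt o} :
    Univ M ↔ ∃ γ, IsInaccOrd γ ∧ M.1 = V_ γ :=
  ⟨fun h => ⟨_, h.isInaccOrd ho, h.eq_vonNeumann ho⟩, fun ⟨_, hγ, hM⟩ => univ_vonNeumann ho hγ hM⟩

end Universes

section Elementarity

open ZFSet
open scoped Classical

variable {o γ δ : Ordinal}

/-- The inclusion between two levels of the cumulative hierarchy. -/
def incl (h : δ ≤ γ) (x : Vt δ) : Vt γ := ⟨x.1, x.2.trans_le h⟩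

theorem infinite_vt (hδ : Order.IsSuccLimit δ) : Infinite (Vt δ) := by
  refine Infinite.of_injective (fun n : ℕ => (⟨(n : Ordinal).toZFSet, ?_⟩ : Vt δ)) fun m n h => ?_
  · rw [Ordinal.rank_toZFSet]
    exact (Ordinal.natCast_lt_omega0 n).trans_le (Ordinal.omega0_le_of_isSuccLimit hδ)
  · simpa using Ordinal.toZFSet_injective (congrArg Subtype.val h)

/-- A family of sets of assignments that contains the atomic ones, is closed under the logical
operations, and passes the Tarski-Vaught test. -/
structure ElemFam (h : δ ≤ γ) (D : Set (Set (Vt δ → Vt γ))) : Prop where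
  falsum : ∅ ∈ D
  mem : ∀ i j, {g : Vt δ → Vt γ | (g i).1 ∈ (g j).1} ∈ D
  eq : ∀ i j, {g : Vt δ → Vt γ | g i = g j} ∈ D
  imp : ∀ X ∈ D, ∀ Y ∈ D, {g | g ∈ X → g ∈ Y} ∈ D
  all : ∀ X ∈ D, ∀ i, {g | ∀ a, Function.update g i a ∈ X} ∈ D
  exists_mem : ∀ X ∈ D, ∀ i, ∀ f : Vt δ → Vt δ, (∃ a, Function.update (incl h ∘ f) i a ∈ X) →
    ∃ a, Function.update (incl h ∘ f) i (incl h a) ∈ X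

theorem ElemFam.exists_formula (hδ : Order.IsSuccLimit δ) {h : δ ≤ γ}
    {D : Set (Set (Vt δ → Vt γ))} (hD : ElemFam h D) {n : ℕ} (φ : LSet.BoundedFormula Empty n)
    (ρ : Fin n → Vt δ) : ∃ X ∈ D, ∀ g, g ∈ X ↔ φ.Realize default (g ∘ ρ) := by
  have hterm : ∀ {n : ℕ} (t : LSet.Term (Empty ⊕ Fin n)) (ρ : Fin n → Vt δ), ∃ i : Vt δ,
      ∀ g : Vt δ → Vt γ, t.realize (Sum.elim default (g ∘ ρ)) = g i := by
    rintro n (v | ⟨f, -⟩) ρ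
    · rcases v with v | v
      · exact v.elim
      · exact ⟨ρ v, fun g => rfl⟩
    · exact f.elim
  induction φ with
  | falsum => exact ⟨∅, hD.falsum, fun g => Iff.rfl⟩
  | equal t₁ t₂ =>
    obtain ⟨i, hi⟩ := hterm t₁ ρ
    obtain ⟨j, hj⟩ := hterm t₂ ρ
    refine ⟨_, hD.eq i j, fun g => ?_⟩
    rw [Set.mem_ofPred_eq, ← hi g, ← hj g]
    rfl
  | rel R ts =>
    cases R
    obtain ⟨i, hi⟩ := hterm (ts 0) ρ
    obtain ⟨j, hj⟩ := hterm (ts 1) ρ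
    refine ⟨_, hD.mem i j, fun g => ?_⟩
    change (g i).1 ∈ (g j).1 ↔ _
    rw [← hi g, ← hj g]
    rfl
  | imp _ _ ih₁ ih₂ =>
    obtain ⟨X, hX, hX'⟩ := ih₁ ρ
    obtain ⟨Y, hY, hY'⟩ := ih₂ ρ
    refine ⟨_, hD.imp X hX Y hY, fun g => ?_⟩
    rw [Set.mem_ofPred_eq, hX', hY', BoundedFormula.realize_imp]
  | all φ ih =>
    have := infinite_vt hδ
    obtain ⟨i, hi⟩ := (Set.finite_range ρ).exists_notMem
    obtain ⟨X, hX, hX'⟩ := ih (Fin.snoc ρ i)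
    refine ⟨_, hD.all X hX i, fun g => ?_⟩
    rw [Set.mem_ofPred_eq, BoundedFormula.realize_all]
    refine forall_congr' fun a => (hX' _).trans (iff_of_eq ?_)
    congr 1
    funext k
    refine Fin.lastCases ?_ (fun k => ?_) k
    · simp
    · have : ρ k ≠ i := fun hk => hi ⟨k, hk⟩
      simp [this]

theorem ElemFam.vElem (hδ : Order.IsSuccLimit δ) {h : δ ≤ γ} {D : Set (Set (Vt δ → Vt γ))}
    (hD : ElemFam h D) : VElem δ γ := by
  let f : Vt δ ↪[LSet] Vt γ :=
    { toFun := incl h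
      inj' := fun x y hxy => Subtype.ext (congrArg Subtype.val hxy :)
      map_fun' := fun f => f.elim
      map_rel' := fun R x => by
        cases R
        rfl }
  refine ⟨f.toElementaryEmbedding ?_, fun x => rfl⟩
  intro n φ x a ha
  have := infinite_vt hδ
  let ρ : Fin (n + 1) → Vt δ := fun k => Infinite.natEmbedding (Vt δ) k
  have hρ : Function.Injective ρ := fun k l hkl =>
    Fin.ext ((Infinite.natEmbedding (Vt δ)).injective hkl)
  obtain ⟨X, hX, hX'⟩ := hD.exists_formula hδ φ ρ
  let g : Vt δ → Vt δ := Function.extend (ρ ∘ Fin.castSucc) x id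
  have hg : ∀ b : Vt γ, Function.update (incl h ∘ g) (ρ (Fin.last n)) b ∘ ρ =
      Fin.snoc (incl h ∘ x) b := fun b => by
    funext k
    refine Fin.lastCases ?_ (fun k => ?_) k
    · simp
    · have h₁ : ρ k.castSucc ≠ ρ (Fin.last n) := fun hk => (Fin.castSucc_lt_last k).ne (hρ hk)
      have h₂ : g (ρ k.castSucc) = x k :=
        (hρ.comp (Fin.castSucc_injective n)).extend_apply x id k
      simp [h₁, h₂]
  obtain ⟨b, hb⟩ := hD.exists_mem X hX (ρ (Fin.last n)) g ⟨a, by rw [hX', hg]; exact ha⟩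
  refine ⟨b, ?_⟩
  rw [hX', hg] at hb
  exact hb

theorem VElem.exists_elemFam (h : δ ≤ γ) (H : VElem δ γ) : ∃ D, ElemFam (δ := δ) (γ := γ) h D := by
  obtain ⟨e, he⟩ := H
  have he' : ∀ x, e x = incl h x := fun x => Subtype.ext (he x)
  refine ⟨{S | ∃ ψ : LSet.Formula (Vt δ), ∀ g, g ∈ S ↔ ψ.Realize g}, ?_, ?_, ?_, ?_, ?_, ?_⟩
  · exact ⟨⊥, fun g => Iff.rfl⟩
  · intro i j
    refine ⟨Relations.formula₂ Language.adj (Term.var i) (Term.var j), fun g => ?_⟩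
    rw [Formula.realize_rel₂]
    rfl
  · intro i j
    refine ⟨Term.equal (Term.var i) (Term.var j), fun g => ?_⟩
    rw [Formula.realize_equal]
    rfl
  · rintro X ⟨φ, hφ⟩ Y ⟨ψ, hψ⟩
    exact ⟨φ.imp ψ, fun g => by rw [Formula.realize_imp, ← hφ, ← hψ]; rfl⟩
  · rintro X ⟨φ, hφ⟩ i
    obtain ⟨ψ, hψ⟩ := exists_formula_forall φ
      (fun j => if j = i then Sum.inr (0 : Fin 1) else Sum.inl j)
    refine ⟨ψ, fun g => ?_⟩
    rw [hψ, Set.mem_ofPred_eq]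
    refine forall_congr' fun a => (hφ _).trans (iff_of_eq ?_)
    congr 1
    funext j
    by_cases hj : j = i <;> simp [hj]
  · rintro X ⟨φ, hφ⟩ i f ⟨a, ha⟩
    obtain ⟨ψ, hψ⟩ := exists_formula_forall φ.not
      (fun j => if j = i then Sum.inr (0 : Fin 1) else Sum.inl j)
    have key : ∀ (K : Type 1) [LSet.Structure K] (v : Vt δ → K) (b : K),
        (fun j => Sum.elim v (fun _ => b) (if j = i then Sum.inr (0 : Fin 1) else Sum.inl j)) =
          Function.update v i b := fun K _ v b => by
      funext j
      by_cases hj : j = i <;> simp [hj]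
    have hef : e ∘ f = incl h ∘ f := funext fun x => he' _
    by_contra! hc
    have h₁ : ψ.Realize f := by
      rw [hψ]
      intro b
      rw [key, Formula.realize_not, ← e.map_formula, ← hφ]
      convert hc b
      funext j
      by_cases hj : j = i <;> simp [hj, he', Function.update]
    rw [← e.map_formula, hef, hψ] at h₁
    have h₂ := h₁ a
    rw [key, Formula.realize_not, ← hφ] at h₂
    exact h₂ ha

/-- The set-theoretic graph of an assignment. -/
noncomputable def code (g : Vt δ → Vt γ) : ZFSet.{0} :=
  graphOn (V_ δ) fun x => if h : x.rank < δ then (g ⟨x, h⟩).1 else ∅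

theorem mem_code {g : Vt δ → Vt γ} {p : ZFSet} : p ∈ code g ↔ ∃ i, p = pair i.1 (g i).1 := by
  rw [code, mem_graphOn]
  constructor
  · rintro ⟨i, hi, rfl⟩
    rw [mem_vonNeumann] at hi
    exact ⟨⟨i, hi⟩, by rw [dif_pos hi]⟩
  · rintro ⟨i, rfl⟩
    exact ⟨i.1, mem_vonNeumann.2 i.2, by rw [dif_pos i.2]⟩

theorem pair_mem_code {g : Vt δ → Vt γ} {i : Vt δ} {a : ZFSet} :
    pair i.1 a ∈ code g ↔ a = (g i).1 := by
  rw [mem_code]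
  constructor
  · rintro ⟨j, h⟩
    obtain ⟨h₁, h₂⟩ := pair_inj.1 h
    rwa [Subtype.ext h₁]
  · rintro rfl
    exact ⟨i, rfl⟩

theorem code_injective : Function.Injective (code : (Vt δ → Vt γ) → ZFSet) := fun f g h => by
  funext i
  have : pair i.1 (f i).1 ∈ code f := pair_mem_code.2 rfl
  rw [h, pair_mem_code] at this
  exact Subtype.ext this

theorem code_incl_comp (h : δ ≤ γ) (f : Vt δ → Vt δ) : code (incl h ∘ f) = code f := by
  refine ZFSet.ext fun p => ?_
  rw [mem_code, mem_code]
  rfl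

theorem rank_code_le (h : δ ≤ γ) (g : Vt δ → Vt γ) : (code g).rank ≤ γ + 2 := by
  rw [rank_le_iff]
  intro p hp
  obtain ⟨i, rfl⟩ := mem_code.1 hp
  refine (rank_pair_le (i.2.trans_le h) (g i).2).trans_lt ?_
  rw [Order.succ_eq_add_one]
  gcongr
  exact one_lt_two

theorem add_nat_lt (ho : Order.IsSuccLimit o) (hγ : γ < o) (n : ℕ) : γ + n < o := by
  induction n with
  | zero => simpa using hγ
  | succ n ih =>
    rw [Nat.cast_succ, ← add_assoc, ← Order.succ_eq_add_one]
    exact ho.succ_lt ih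

theorem assign_iff {N M σ : Vt o} (hN : N.1 = V_ δ) (hM : M.1 = V_ γ) :
    Assign N M σ ↔ ∃ g : Vt δ → Vt γ, σ.1 = code g := by
  have hδ : δ < o := by simpa [hN] using N.2
  have hγ : γ < o := by simpa [hM] using M.2
  constructor
  · rintro ⟨h₁, h₂, h₃⟩
    have hex : ∀ i : Vt δ, ∃ a : Vt γ, pair i.1 a.1 ∈ σ.1 := fun i => by
      obtain ⟨a, ha⟩ := h₂ ⟨i.1, i.2.trans hδ⟩ (by rw [hN, mem_vonNeumann]; exact i.2)
      obtain ⟨j, hj, b, hb, hp⟩ := h₁ ⟨_, rank_lt_of_mem_vt ha⟩ ha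
      obtain ⟨-, h₅⟩ := pair_inj.1 hp
      rw [hM, mem_vonNeumann] at hb
      exact ⟨⟨b.1, hb⟩, by rw [← h₅]; exact ha⟩
    choose g hg using hex
    refine ⟨g, ZFSet.ext fun p => ?_⟩
    rw [mem_code]
    constructor
    · intro hp
      obtain ⟨i, hi, a, ha, hpia⟩ := h₁ ⟨p, rank_lt_of_mem_vt hp⟩ hp
      rw [hN, mem_vonNeumann] at hi
      have hpia' : p = pair i.1 a.1 := hpia
      have := h₃ i a ⟨_, (g ⟨i.1, hi⟩).2.trans hγ⟩ (by rw [App, ← hpia']; exact hp) (hg ⟨i.1, hi⟩)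
      exact ⟨⟨i.1, hi⟩, by rw [hpia', this]⟩
    · rintro ⟨i, rfl⟩
      exact hg i
  · rintro ⟨g, hg⟩
    refine ⟨fun p hp => ?_, fun i hi => ?_, fun i a b ha hb => ?_⟩
    · rw [hg] at hp
      obtain ⟨i, hi⟩ := mem_code.1 hp
      refine ⟨⟨i.1, i.2.trans hδ⟩, ?_, ⟨(g i).1, (g i).2.trans hγ⟩, ?_, hi⟩
      · rw [hN, mem_vonNeumann]
        exact i.2
      · rw [hM, mem_vonNeumann]
        exact (g i).2
    · rw [hN, mem_vonNeumann] at hi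
      refine ⟨⟨_, (g ⟨i.1, hi⟩).2.trans hγ⟩, ?_⟩
      rw [App, hg]
      exact pair_mem_code (i := ⟨i.1, hi⟩).2 rfl
    · rw [App, hg] at ha hb
      have hi : i.1.rank < δ := by
        obtain ⟨j, hj⟩ := mem_code.1 ha
        rw [(pair_inj.1 hj).1]
        exact j.2
      exact Subtype.ext ((pair_mem_code (i := ⟨i.1, hi⟩).1 ha).trans
        (pair_mem_code (i := ⟨i.1, hi⟩).1 hb).symm)

theorem app_code_iff {σ i a : Vt o} {g : Vt δ → Vt γ} (hσ : σ.1 = code g) (hi : i.1.rank < δ) :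
    App σ i a ↔ a.1 = (g ⟨i.1, hi⟩).1 := by
  rw [App, hσ]
  exact pair_mem_code (i := ⟨i.1, hi⟩)

theorem agree_code_iff {η : Ordinal} {N i σ τ : Vt o} (hN : N.1 = V_ δ) (hη : η ≤ γ) (hγ : γ < o)
    (hi : i.1.rank < δ) {f : Vt δ → Vt η} {g : Vt δ → Vt γ} (hσ : σ.1 = code f)
    (hτ : τ.1 = code g) :
    Agree N i σ τ ↔ g = Function.update (incl hη ∘ f) ⟨i.1, hi⟩ (g ⟨i.1, hi⟩) := by
  have hδ : δ < o := by simpa [hN] using N.2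
  constructor
  · intro h
    funext j
    by_cases hj : j = ⟨i.1, hi⟩
    · simp [hj]
    · have := (h ⟨j.1, j.2.trans hδ⟩ (by rw [hN, mem_vonNeumann]; exact j.2)
        (fun h => hj (Subtype.ext (congrArg Subtype.val h :)))
        ⟨(g j).1, (g j).2.trans hγ⟩).2 ((app_code_iff hτ j.2).2 rfl)
      rw [app_code_iff hσ j.2] at this
      rw [Function.update_of_ne hj]
      exact Subtype.ext this
  · intro h j hj hji a
    rw [hN, mem_vonNeumann] at hj
    rw [app_code_iff hσ hj, app_code_iff hτ hj, h, Function.update_of_ne]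
    · rfl
    · exact fun h => hji (Subtype.ext (congrArg Subtype.val h :))

theorem ElemIn.exists_elemFam (ho : Order.IsSuccLimit o) {N M : Vt o} (hN : N.1 = V_ δ)
    (hM : M.1 = V_ γ) (h : δ ≤ γ) (H : ElemIn N M) :
    ∃ D, ElemFam (δ := δ) (γ := γ) h D := by
  have hδ : δ < o := by simpa [hN] using N.2
  have hγ : γ < o := by simpa [hM] using M.2
  have hrank : ∀ g : Vt δ → Vt γ, (code g).rank < o := fun g =>
    (rank_code_le h g).trans_lt (add_nat_lt ho hγ 2)
  have hrank' : ∀ g : Vt δ → Vt δ, (code g).rank < o := fun g =>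
    (rank_code_le le_rfl g).trans_lt (add_nat_lt ho hδ 2)
  have hass : ∀ g : Vt δ → Vt γ, Assign N M ⟨code g, hrank g⟩ := fun g =>
    (assign_iff hN hM).2 ⟨g, rfl⟩
  have hass' : ∀ g : Vt δ → Vt δ, Assign N N ⟨code g, hrank' g⟩ := fun g =>
    (assign_iff hN hN).2 ⟨g, rfl⟩
  have hmem : ∀ i : Vt δ, i.1 ∈ N.1 := fun i => by
    rw [hN, mem_vonNeumann]
    exact i.2
  have happ : ∀ (g : Vt δ → Vt γ) (i : Vt δ) (a : Vt o),
      App ⟨code g, hrank g⟩ ⟨i.1, i.2.trans hδ⟩ a ↔ a.1 = (g i).1 := fun g i a =>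
    app_code_iff (i := ⟨i.1, i.2.trans hδ⟩) rfl i.2
  obtain ⟨D, h₁, h₂, h₃, h₄, h₅, h₆⟩ := H
  refine ⟨{S | ∃ X : Vt o, X.1 ∈ D.1 ∧ ∀ g, g ∈ S ↔ code g ∈ X.1}, ?_, ?_, ?_, ?_, ?_, ?_⟩
  · obtain ⟨X, hX, hX'⟩ := h₁
    exact ⟨X, hX, fun g => ⟨False.elim, fun hg => hX' _ (hass g) hg⟩⟩
  · intro i j
    obtain ⟨X, hX, hX'⟩ := h₂ ⟨i.1, i.2.trans hδ⟩ (hmem i) ⟨j.1, j.2.trans hδ⟩ (hmem j)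
    refine ⟨X, hX, fun g => ?_⟩
    rw [hX' _ (hass g)]
    constructor
    · intro hg
      exact ⟨⟨_, (g i).2.trans hγ⟩, ⟨_, (g j).2.trans hγ⟩, (happ g i _).2 rfl,
        (happ g j _).2 rfl, hg⟩
    · rintro ⟨a, b, ha, hb, hab⟩
      rwa [(happ g i _).1 ha, (happ g j _).1 hb] at hab
  · intro i j
    obtain ⟨X, hX, hX'⟩ := h₃ ⟨i.1, i.2.trans hδ⟩ (hmem i) ⟨j.1, j.2.trans hδ⟩ (hmem j)
    refine ⟨X, hX, fun g => ?_⟩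
    rw [hX' _ (hass g)]
    constructor
    · intro hg
      exact ⟨⟨_, (g i).2.trans hγ⟩, (happ g i _).2 rfl,
        (happ g j _).2 (congrArg Subtype.val hg)⟩
    · rintro ⟨a, ha, hb⟩
      exact Subtype.ext (((happ g i _).1 ha).symm.trans ((happ g j _).1 hb))
  · rintro S ⟨X, hX, hSX⟩ T ⟨Y, hY, hTY⟩
    obtain ⟨Z, hZ, hZ'⟩ := h₄ X hX Y hY
    refine ⟨Z, hZ, fun g => ?_⟩
    rw [hZ' _ (hass g), Set.mem_ofPred_eq, hSX, hTY]
  · rintro S ⟨X, hX, hSX⟩ i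
    obtain ⟨Z, hZ, hZ'⟩ := h₅ X hX ⟨i.1, i.2.trans hδ⟩ (hmem i)
    refine ⟨Z, hZ, fun g => ?_⟩
    rw [hZ' _ (hass g), Set.mem_ofPred_eq]
    constructor
    · intro hg τ hτ hag
      obtain ⟨f, hf⟩ := (assign_iff hN hM).1 hτ
      rw [agree_code_iff hN le_rfl hγ i.2 rfl hf] at hag
      rw [hf, ← hSX, hag]
      exact hg _
    · intro hg a
      rw [hSX]
      refine hg ⟨_, hrank _⟩ (hass _) ?_
      rw [agree_code_iff hN le_rfl hγ i.2 rfl rfl]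
      simp only [Function.update_self]
      rfl
  · rintro S ⟨X, hX, hSX⟩ i f ⟨a, ha⟩
    obtain ⟨τ, hτ, hag, hτX⟩ := h₆ X hX ⟨i.1, i.2.trans hδ⟩ (hmem i) ⟨code f, hrank' f⟩ (hass' f)
      ⟨⟨code (Function.update (incl h ∘ f) i a), hrank _⟩, hass _, by
        rw [agree_code_iff hN h hγ i.2 rfl rfl]
        simp only [Function.update_self], (hSX _).1 ha⟩
    obtain ⟨g, hg⟩ := (assign_iff hN hN).1 hτ
    rw [agree_code_iff hN le_rfl hδ i.2 rfl hg] at hag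
    refine ⟨g i, ?_⟩
    rw [hSX]
    have : Function.update (incl h ∘ f) i (incl h (g i)) = incl h ∘ g := by
      rw [hag]
      funext j
      by_cases hj : j = i
      · subst hj
        simp
      · simp [hj]
        rfl
    rw [this, code_incl_comp, ← hg]
    exact hτX

/-- The set of the graphs of the assignments in `S`. -/
noncomputable def codeSet (S : Set (Vt δ → Vt γ)) : ZFSet.{0} :=
  ZFSet.sep (fun σ => ∃ g ∈ S, σ = code g) (V_ (γ + 3))

theorem code_mem_codeSet (h : δ ≤ γ) {S : Set (Vt δ → Vt γ)} {g : Vt δ → Vt γ} :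
    code g ∈ codeSet S ↔ g ∈ S := by
  rw [codeSet, ZFSet.mem_sep]
  constructor
  · rintro ⟨-, f, hf, hfg⟩
    rwa [code_injective hfg]
  · intro hg
    refine ⟨?_, g, hg, rfl⟩
    rw [mem_vonNeumann]
    refine (rank_code_le h g).trans_lt ?_
    gcongr
    norm_num

theorem rank_codeSet_le (S : Set (Vt δ → Vt γ)) : (codeSet S).rank ≤ γ + 3 := by
  rw [← rank_vonNeumann (γ + 3)]
  exact rank_mono (ZFSet.sep_subset)

theorem ElemFam.elemIn (ho : Order.IsSuccLimit o) {N M : Vt o} (hN : N.1 = V_ δ)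
    (hM : M.1 = V_ γ) (h : δ ≤ γ) {D : Set (Set (Vt δ → Vt γ))} (hD : ElemFam h D) :
    ElemIn N M := by
  have hδ : δ < o := by simpa [hN] using N.2
  have hγ : γ < o := by simpa [hM] using M.2
  have hrank : ∀ g : Vt δ → Vt γ, (code g).rank < o := fun g =>
    (rank_code_le h g).trans_lt (add_nat_lt ho hγ 2)
  have hrank' : ∀ g : Vt δ → Vt δ, (code g).rank < o := fun g =>
    (rank_code_le le_rfl g).trans_lt (add_nat_lt ho hδ 2)
  have hset : ∀ S : Set (Vt δ → Vt γ), (codeSet S).rank < o := fun S =>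
    (rank_codeSet_le S).trans_lt (add_nat_lt ho hγ 3)
  let E : ZFSet := ZFSet.sep (fun X => ∃ S ∈ D, X = codeSet S) (V_ (γ + 4))
  have hE : ∀ {X : ZFSet}, X ∈ E ↔ ∃ S ∈ D, X = codeSet S := fun {X} => by
    rw [ZFSet.mem_sep]
    refine ⟨And.right, fun hX => ⟨?_, hX⟩⟩
    obtain ⟨S, -, rfl⟩ := hX
    rw [mem_vonNeumann]
    refine (rank_codeSet_le S).trans_lt ?_
    gcongr
    norm_num
  have hEo : E.rank < o := by
    refine lt_of_le_of_lt ?_ (add_nat_lt ho hγ 4)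
    rw [← rank_vonNeumann (γ + (4 : ℕ))]
    exact rank_mono ZFSet.sep_subset
  have hmk : ∀ {S : Set (Vt δ → Vt γ)} {p : Vt o → Prop}, S ∈ D →
      (∀ (g : Vt δ → Vt γ) (σ : Vt o), σ.1 = code g → (g ∈ S ↔ p σ)) →
      ∃ X : Vt o, X.1 ∈ E ∧ ∀ σ : Vt o, Assign N M σ → (σ.1 ∈ X.1 ↔ p σ) := fun {S p} hS hp => by
    refine ⟨⟨codeSet S, hset S⟩, hE.2 ⟨S, hS, rfl⟩, fun σ hσ => ?_⟩
    obtain ⟨g, hg⟩ := (assign_iff hN hM).1 hσ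
    rw [← hp g σ hg, hg, code_mem_codeSet h]
  refine ⟨⟨E, hEo⟩, ?_, ?_, ?_, ?_, ?_, ?_⟩
  · obtain ⟨X, hX, hX'⟩ := hmk (p := fun _ => False) hD.falsum fun g σ _ => Iff.rfl
    exact ⟨X, hX, fun σ hσ => (hX' σ hσ).1⟩
  · intro i hi j hj
    rw [hN, mem_vonNeumann] at hi hj
    refine hmk (hD.mem ⟨i.1, hi⟩ ⟨j.1, hj⟩) fun g σ hσ => ?_
    constructor
    · intro hg
      exact ⟨⟨_, (g ⟨i.1, hi⟩).2.trans hγ⟩, ⟨_, (g ⟨j.1, hj⟩).2.trans hγ⟩,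
        (app_code_iff hσ hi).2 rfl, (app_code_iff hσ hj).2 rfl, hg⟩
    · rintro ⟨a, b, ha, hb, hab⟩
      rwa [(app_code_iff hσ hi).1 ha, (app_code_iff hσ hj).1 hb] at hab
  · intro i hi j hj
    rw [hN, mem_vonNeumann] at hi hj
    refine hmk (hD.eq ⟨i.1, hi⟩ ⟨j.1, hj⟩) fun g σ hσ => ?_
    constructor
    · intro hg
      exact ⟨⟨_, (g ⟨i.1, hi⟩).2.trans hγ⟩, (app_code_iff hσ hi).2 rfl,
        (app_code_iff hσ hj).2 (congrArg Subtype.val hg)⟩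
    · rintro ⟨a, ha, hb⟩
      exact Subtype.ext (((app_code_iff hσ hi).1 ha).symm.trans ((app_code_iff hσ hj).1 hb))
  · intro X hX Y hY
    obtain ⟨S, hS, hXS⟩ := hE.1 hX
    obtain ⟨T, hT, hYT⟩ := hE.1 hY
    refine hmk (hD.imp S hS T hT) fun g σ hσ => ?_
    rw [hXS, hYT, hσ, code_mem_codeSet h, code_mem_codeSet h]
    rfl
  · intro X hX i hi
    rw [hN, mem_vonNeumann] at hi
    obtain ⟨S, hS, hXS⟩ := hE.1 hX
    refine hmk (hD.all S hS ⟨i.1, hi⟩) fun g σ hσ => ?_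
    constructor
    · intro hg τ hτ hag
      obtain ⟨f, hf⟩ := (assign_iff hN hM).1 hτ
      rw [agree_code_iff hN le_rfl hγ hi hσ hf] at hag
      rw [hXS, hf, code_mem_codeSet h, hag]
      exact hg _
    · intro hg a
      rw [← code_mem_codeSet h, ← hXS]
      refine hg ⟨_, hrank _⟩ ((assign_iff hN hM).2 ⟨_, rfl⟩) ?_
      rw [agree_code_iff hN le_rfl hγ hi hσ rfl]
      simp only [Function.update_self]
      rfl
  · rintro X hX i hi σ hσ ⟨τ, hτ, hag, hτX⟩
    rw [hN, mem_vonNeumann] at hi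
    obtain ⟨S, hS, hXS⟩ := hE.1 hX
    obtain ⟨f, hf⟩ := (assign_iff hN hN).1 hσ
    obtain ⟨g, hg⟩ := (assign_iff hN hM).1 hτ
    rw [agree_code_iff hN h hγ hi hf hg] at hag
    rw [hXS, hg, code_mem_codeSet h, hag] at hτX
    obtain ⟨a, ha⟩ := hD.exists_mem S hS ⟨i.1, hi⟩ f ⟨_, hτX⟩
    refine ⟨⟨code (Function.update f ⟨i.1, hi⟩ a), hrank' _⟩, (assign_iff hN hN).2 ⟨_, rfl⟩, ?_, ?_⟩
    · rw [agree_code_iff hN le_rfl hδ hi hf rfl]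
      simp only [Function.update_self]
      rfl
    · change code _ ∈ X.1
      rw [hXS, ← code_incl_comp h, code_mem_codeSet h]
      convert ha
      funext j
      by_cases hj : j = ⟨i.1, hi⟩ <;> simp [hj]

theorem elemIn_iff (ho : Order.IsSuccLimit o) (hδ : Order.IsSuccLimit δ) {N M : Vt o}
    (hN : N.1 = V_ δ) (hM : M.1 = V_ γ) (h : δ ≤ γ) : ElemIn N M ↔ VElem δ γ := by
  constructor
  · intro H
    obtain ⟨D, hD⟩ := H.exists_elemFam ho hN hM h
    exact hD.vElem hδ
  · intro H
    obtain ⟨D, hD⟩ := H.exists_elemFam h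
    exact hD.elemIn ho hN hM h

end Elementarity

section Recursion

open ZFSet

variable {o γ δ : Ordinal}

/-- `V_γ` is a proper elementary extension of `V_δ`, with both heights inaccessible. -/
def ExtAt (δ γ : Ordinal) : Prop := IsInaccOrd δ ∧ IsInaccOrd γ ∧ δ < γ ∧ VElem δ γ

theorem univExt_iff (ho : Order.IsSuccLimit o) {d M : Vt o} (hd : d.1 = δ.toZFSet) :
    UnivExt d M ↔ ∃ γ, M.1 = V_ γ ∧ ExtAt δ γ := by
  have hδo : δ < o := by simpa [hd] using d.2
  constructor
  · rintro ⟨N, hNM, hN, hdN, hdN', hM, hel⟩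
    obtain ⟨η, hη, hNη⟩ := (univ_iff ho).1 hN
    obtain ⟨γ, hγ, hMγ⟩ := (univ_iff ho).1 hM
    have h₁ : δ ≤ η := by
      have : d.1 ⊆ V_ η := fun x hx => by
        rw [← hNη]
        exact hdN ⟨x, rank_lt_of_mem_vt hx⟩ hx
      simpa [subset_vonNeumann, hd] using this
    have h₂ : η ≤ δ := by
      rw [hNη, mem_vonNeumann, hd, Ordinal.rank_toZFSet] at hdN'
      exact not_lt.1 hdN'
    obtain rfl := h₁.antisymm h₂
    rw [hNη, hMγ, vonNeumann_mem_vonNeumann_iff] at hNM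
    exact ⟨γ, hMγ, hη, hγ, hNM, (elemIn_iff ho hη.isSuccLimit hNη hMγ hNM.le).1 hel⟩
  · rintro ⟨γ, hM, hδ, hγ, hlt, hel⟩
    refine ⟨⟨V_ δ, by simpa using hδo⟩, ?_, univ_vonNeumann ho hδ rfl, fun x hx => ?_, ?_,
      univ_vonNeumann ho hγ hM, (elemIn_iff ho hδ.isSuccLimit rfl hM hlt.le).2 hel⟩
    · rw [hM]
      exact vonNeumann_mem_of_lt hlt
    · rw [hd] at hx
      exact Ordinal.toZFSet_subset_vonNeumann δ hx
    · rw [hd, mem_vonNeumann, Ordinal.rank_toZFSet]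
      exact lt_irrefl δ

/-- The ordinal `b ≤ t` has not been hit, according to `H`, at any level above `t`. -/
def OrdCand (H : Ordinal → Ordinal → Prop) (t b : Ordinal) : Prop :=
  b ≤ t ∧ ∀ m, H m b → m ≤ t

/-- The least `t` occurring in a candidate pair. -/
noncomputable def leastStage (H : Ordinal.{0} → Ordinal.{0} → Prop) : Ordinal.{0} :=
  sInf {t | ∃ b, OrdCand H t b}

/-- The second entry of the lexicographically least candidate pair. -/
noncomputable def leastValue (H : Ordinal.{0} → Ordinal.{0} → Prop) : Ordinal.{0} :=
  sInf {b | OrdCand H (leastStage H) b}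

section Least

variable {H : Ordinal.{0} → Ordinal.{0} → Prop}

theorem ordCand_zero (hH : ∀ m b, H m b → m ≤ o) : OrdCand H o 0 :=
  ⟨zero_le, fun m hm => hH m 0 hm⟩

theorem leastStage_le {t b : Ordinal} (h : OrdCand H t b) : leastStage H ≤ t :=
  csInf_le' ⟨b, h⟩

theorem leastValue_le {b : Ordinal} (h : OrdCand H (leastStage H) b) : leastValue H ≤ b :=
  csInf_le' h

theorem ordCand_leastValue (hH : ∀ m b, H m b → m ≤ o) :
    OrdCand H (leastStage H) (leastValue H) :=
  csInf_mem (s := {b | OrdCand H (leastStage H) b})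
    (csInf_mem (s := {t | ∃ b, OrdCand H t b}) ⟨o, 0, ordCand_zero hH⟩)

theorem leastValue_lt (h₀ : 0 < o) (hH : ∀ m b, H m b → m ≤ o) : leastValue H < o := by
  rcases (leastStage_le (ordCand_zero hH)).lt_or_eq with h | h
  · exact (ordCand_leastValue hH).1.trans_lt h
  · refine (leastValue_le ?_).trans_lt h₀
    rw [h]
    exact ordCand_zero hH

theorem leastCand_iff (ho : Order.IsSuccLimit o) {H' : Vt o → Vt o → Prop}
    (hH : ∀ m b, H m b → m < o)
    (hH' : ∀ m b : Vt o, H' m b ↔ ∃ μ β : Ordinal, m.1 = V_ μ ∧ b.1 = β.toZFSet ∧ H μ β)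
    {y : Vt o} : LeastCand H' y ↔ y.1 = (leastValue H).toZFSet := by
  have hle : ∀ m b, H m b → m ≤ o := fun m b h => (hH m b h).le
  have hcand : ∀ {t b : Vt o}, Cand H' t b ↔
      ∃ τ β : Ordinal, t.1 = τ.toZFSet ∧ b.1 = β.toZFSet ∧ OrdCand H τ β := fun {t b} => by
    constructor
    · rintro ⟨ht, hb, hbt, h⟩
      refine ⟨t.1.rank, b.1.rank, ht.toZFSet_rank_eq.symm, hb.toZFSet_rank_eq.symm, ?_, ?_⟩
      · exact rank_mono fun x hx => hbt ⟨x, rank_lt_of_mem_vt hx⟩ hx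
      · intro μ hμ
        have := h ⟨V_ μ, by simpa using hH _ _ hμ⟩ ((hH' _ _).2
          ⟨μ, b.1.rank, rfl, hb.toZFSet_rank_eq.symm, hμ⟩)
        rw [mem_vonNeumann] at this
        exact not_lt.1 this
    · rintro ⟨τ, β, ht, hb, hβτ, h⟩
      refine ⟨?_, ?_, fun x hx => ?_, fun m hm => ?_⟩
      · rw [IsOrd, ht]
        exact isOrdinal_toZFSet τ
      · rw [IsOrd, hb]
        exact isOrdinal_toZFSet β
      · rw [hb] at hx
        rw [ht]
        exact Ordinal.toZFSet_subset_toZFSet_iff.2 hβτ hx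
      · obtain ⟨μ, β', hmμ, hbβ', hμ⟩ := (hH' _ _).1 hm
        obtain rfl := Ordinal.toZFSet_injective (hb.symm.trans hbβ')
        rw [ht, hmμ, mem_vonNeumann, Ordinal.rank_toZFSet, not_lt]
        exact h μ hμ
  have hmem := ordCand_leastValue hle
  have hval := leastValue_lt ho.bot_lt hle
  have hcand₀ : ∀ hT : leastStage H < o,
      Cand H' ⟨(leastStage H).toZFSet, by simpa using hT⟩
        ⟨(leastValue H).toZFSet, by simpa using hval⟩ := fun hT =>
    hcand.2 ⟨_, _, rfl, rfl, hmem⟩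
  constructor
  · rintro (⟨t, htb, hmin, hmin'⟩ | ⟨hy, hno⟩)
    · obtain ⟨τ, β, ht, hb, hτβ⟩ := hcand.1 htb
      have hτo : τ < o := by simpa [ht] using t.2
      have hT := leastStage_le hτβ
      obtain rfl : leastStage H = τ := hT.eq_of_not_lt fun hlt =>
        hmin ⟨(leastStage H).toZFSet, by simpa using hlt.trans hτo⟩
          (by rw [ht]; exact Ordinal.toZFSet_mem_toZFSet_iff.2 hlt) _ (hcand₀ (hlt.trans hτo))
      have hβ := leastValue_le hτβ
      rw [hb, hβ.eq_of_not_lt fun hlt => ?_]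
      refine hmin' ⟨(leastValue H).toZFSet, by simpa using hval⟩
        (by rw [hb]; exact Ordinal.toZFSet_mem_toZFSet_iff.2 hlt) ?_
      exact hcand.2 ⟨_, _, ht, rfl, hmem⟩
    · have hT : leastStage H = o := (leastStage_le (ordCand_zero hle)).eq_of_not_lt fun hlt =>
        hno _ _ (hcand₀ hlt)
      have hv : leastValue H = 0 := le_antisymm
        (leastValue_le (by rw [hT]; exact ordCand_zero hle)) zero_le
      rw [hv, Ordinal.toZFSet_zero, ZFSet.eq_empty]
      exact fun x hx => hy ⟨x, rank_lt_of_mem_vt hx⟩ hx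
  · intro hy
    rcases (leastStage_le (ordCand_zero hle)).lt_or_eq with hT | hT
    · refine .inl ⟨⟨(leastStage H).toZFSet, by simpa using hT⟩, hcand.2 ⟨_, _, rfl, hy, hmem⟩,
        fun t ht b hc => ?_, fun b hb hc => ?_⟩
      · obtain ⟨τ, β, hτ, -, hτβ⟩ := hcand.1 hc
        rw [hτ, Ordinal.toZFSet_mem_toZFSet_iff] at ht
        exact (leastStage_le hτβ).not_gt ht
      · obtain ⟨τ, β, hτ, hβ, hτβ⟩ := hcand.1 hc
        obtain rfl := Ordinal.toZFSet_injective hτ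
        rw [hy, hβ, Ordinal.toZFSet_mem_toZFSet_iff] at hb
        exact (leastValue_le hτβ).not_gt hb
    · have hv : leastValue H = 0 := le_antisymm
        (leastValue_le (by rw [hT]; exact ordCand_zero hle)) zero_le
      refine .inr ⟨fun x hx => ?_, fun t b hc => ?_⟩
      · rw [hy, hv, Ordinal.toZFSet_zero] at hx
        exact notMem_empty _ hx
      · obtain ⟨τ, β, hτ, -, hτβ⟩ := hcand.1 hc
        have hτo : τ < o := by simpa [hτ] using t.2
        exact (leastStage_le hτβ).not_gt (hT ▸ hτo)

end Least

/-- The anticipating function: `laver δ γ` is the least candidate for `V_δ` in `V_γ`, given the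
values at the smaller elementary extensions of `V_δ`. -/
noncomputable def laver (δ γ : Ordinal.{0}) : Ordinal.{0} :=
  leastValue fun m b => ∃ _ : m < γ, ExtAt δ m ∧ laver δ m = b
termination_by γ

/-- The values of `laver δ` at the elementary extensions of `V_δ` below `γ`. -/
def laverBelow (δ γ m b : Ordinal.{0}) : Prop := m < γ ∧ ExtAt δ m ∧ laver δ m = b

theorem laver_eq (δ γ : Ordinal) : laver δ γ = leastValue (laverBelow δ γ) := by
  rw [laver]
  simp only [exists_prop]
  rfl

theorem laver_lt (δ : Ordinal) (hγ : 0 < γ) : laver δ γ < γ := by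
  rw [laver_eq]
  exact leastValue_lt hγ fun m b h => h.1.le

theorem attempt_app_eq (ho : Order.IsSuccLimit o) {d f : Vt o} (hd : d.1 = δ.toZFSet)
    (hf : Attempt d f) (γ : Ordinal) (m b : Vt o) (hm : m.1 = V_ γ) (h : App f m b) :
    b.1 = (laver δ γ).toZFSet := by
  induction γ using WellFoundedLT.induction generalizing m b with
  | _ γ ih =>
    obtain ⟨hext, hleast, hall⟩ := hf m b h
    have hγ : γ < o := by simpa [hm] using m.2
    rw [laver_eq]
    refine (leastCand_iff ho (fun μ β hμ => hμ.1.trans hγ) fun m' b' => ?_).1 hleast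
    constructor
    · rintro ⟨hm', hf'⟩
      obtain ⟨μ, hμ, hext'⟩ := (univExt_iff ho hd).1 (hf m' b' hf').1
      rw [hμ, hm, vonNeumann_mem_vonNeumann_iff] at hm'
      exact ⟨μ, laver δ μ, hμ, ih μ hm' m' b' hμ hf', hm', hext', rfl⟩
    · rintro ⟨μ, β, hμ, hβ, hlt, hext', rfl⟩
      have hmem : m'.1 ∈ m.1 := by
        rw [hμ, hm]
        exact vonNeumann_mem_of_lt hlt
      obtain ⟨b'', hb''⟩ := hall m' hmem ((univExt_iff ho hd).2 ⟨μ, hμ, hext'⟩)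
      rw [Subtype.ext (hβ.trans (ih μ hlt m' b'' hμ hb'').symm)]
      exact ⟨hmem, hb''⟩

theorem attemptVal_iff (ho : Order.IsSuccLimit o) {d m b : Vt o} (hd : d.1 = δ.toZFSet) :
    AttemptVal d m b ↔ ∃ γ, m.1 = V_ γ ∧ ExtAt δ γ ∧ b.1 = (laver δ γ).toZFSet := by
  constructor
  · rintro ⟨f, hf, happ⟩
    obtain ⟨γ, hγ, hext⟩ := (univExt_iff ho hd).1 (hf m b happ).1
    exact ⟨γ, hγ, hext, attempt_app_eq ho hd hf γ m b hγ happ⟩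
  · rintro ⟨γ, hm, hext, hb⟩
    have hγ : γ < o := by simpa [hm] using m.2
    let x : ZFSet := ZFSet.sep (fun n => ∃ μ, n = V_ μ ∧ ExtAt δ μ) (V_ (Order.succ γ))
    let F : ZFSet → ZFSet := fun n => (laver δ n.rank).toZFSet
    have hx : ∀ {n : ZFSet}, n ∈ x ↔ ∃ μ ≤ γ, n = V_ μ ∧ ExtAt δ μ := fun {n} => by
      rw [ZFSet.mem_sep, mem_vonNeumann]
      constructor
      · rintro ⟨hn, μ, rfl, hμ⟩
        rw [rank_vonNeumann] at hn
        exact ⟨μ, Order.lt_succ_iff.1 hn, rfl, hμ⟩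
      · rintro ⟨μ, hμγ, rfl, hμ⟩
        rw [rank_vonNeumann]
        exact ⟨Order.lt_succ_iff.2 hμγ, μ, rfl, hμ⟩
    have hrank : (graphOn x F).rank < o := by
      refine rank_graphOn_lt ho (ho.succ_lt hγ) ?_ fun n hn => ?_
      · rw [← rank_vonNeumann (Order.succ γ)]
        exact rank_mono ZFSet.sep_subset
      · obtain ⟨μ, hμγ, rfl, hμ⟩ := hx.1 hn
        rw [Ordinal.rank_toZFSet, rank_vonNeumann]
        exact (laver_lt δ hμ.2.1.isSuccLimit.bot_lt).trans_le (hμγ.trans (Order.le_succ γ))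
    have happ : ∀ n c : Vt o, App ⟨graphOn x F, hrank⟩ n c ↔
        ∃ μ ≤ γ, n.1 = V_ μ ∧ ExtAt δ μ ∧ c.1 = (laver δ μ).toZFSet := fun n c => by
      rw [App, pair_mem_graphOn, hx]
      constructor
      · rintro ⟨⟨μ, hμγ, hn, hμ⟩, hc⟩
        refine ⟨μ, hμγ, hn, hμ, ?_⟩
        rw [hc, hn]
        simp only [F, rank_vonNeumann]
      · rintro ⟨μ, hμγ, hn, hμ, hc⟩
        refine ⟨⟨μ, hμγ, hn, hμ⟩, ?_⟩
        rw [hc, hn]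
        simp only [F, rank_vonNeumann]
    refine ⟨⟨graphOn x F, hrank⟩, fun n c hnc => ?_, (happ m b).2 ⟨γ, le_rfl, hm, hext, hb⟩⟩
    obtain ⟨μ, hμγ, hn, hμ, hc⟩ := (happ n c).1 hnc
    refine ⟨(univExt_iff ho hd).2 ⟨μ, hn, hμ⟩, ?_, fun n' hn' hext' => ?_⟩
    · rw [laver_eq] at hc
      refine (leastCand_iff ho (fun ν β hν => hν.1.trans (hμγ.trans_lt hγ)) fun n' c' => ?_).2 hc
      rw [happ]
      constructor
      · rintro ⟨hn', ν, hνγ, hnν, hν, hc'⟩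
        rw [hnν, hn, vonNeumann_mem_vonNeumann_iff] at hn'
        exact ⟨ν, _, hnν, hc', hn', hν, rfl⟩
      · rintro ⟨ν, β, hnν, hc', hlt, hν, rfl⟩
        refine ⟨?_, ν, hlt.le.trans hμγ, hnν, hν, hc'⟩
        rw [hnν, hn]
        exact vonNeumann_mem_of_lt hlt
    · obtain ⟨ν, hnν, hν⟩ := (univExt_iff ho hd).1 hext'
      rw [hnν, hn, vonNeumann_mem_vonNeumann_iff] at hn'
      have hlt : (laver δ ν) < o := (laver_lt δ hν.2.1.isSuccLimit.bot_lt).trans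
        (hn'.trans (hμγ.trans_lt hγ))
      exact ⟨⟨(laver δ ν).toZFSet, by simpa using hlt⟩,
        (happ _ _).2 ⟨ν, hn'.le.trans hμγ, hnν, hν, rfl⟩⟩

theorem laverGraph_iff (ho : Order.IsSuccLimit o) (x y : Vt o) :
    LaverGraph x y ↔ fInterp o (fun δ => laver δ o) x = y := by
  by_cases hx : x.1.IsOrdinal
  · have hleast : LeastCand (AttemptVal x) y ↔ y.1 = (laver x.1.rank o).toZFSet := by
      rw [laver_eq]
      refine leastCand_iff ho (fun m b h => h.1) fun m b => ?_
      rw [attemptVal_iff ho hx.toZFSet_rank_eq.symm]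
      constructor
      · rintro ⟨μ, hm, hμ, hb⟩
        exact ⟨μ, _, hm, hb, by simpa [hm] using m.2, hμ, rfl⟩
      · rintro ⟨μ, β, hm, hb, -, hμ, rfl⟩
        exact ⟨μ, hm, hμ, hb⟩
    have hex : x.1.IsOrdinal ∧ ∃ y : ZFSet, y.IsOrdinal ∧ y.rank = laver x.1.rank o ∧
        y.rank < o := by
      refine ⟨hx, (laver x.1.rank o).toZFSet, isOrdinal_toZFSet _, ?_, ?_⟩
      · rw [Ordinal.rank_toZFSet]
      · rw [Ordinal.rank_toZFSet]
        exact laver_lt _ ho.bot_lt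
    have hval : (fInterp o (fun δ => laver δ o) x).1 = (laver x.1.rank o).toZFSet := by
      rw [fInterp, dif_pos hex]
      have hsp := hex.2.choose_spec
      exact hsp.1.toZFSet_rank_eq.symm.trans (congrArg Ordinal.toZFSet hsp.2.1)
    rw [LaverGraph, hleast]
    simp only [IsOrd, hx, true_and, not_true_eq_false, false_and, or_false]
    rw [Subtype.ext_iff (a1 := fInterp o _ x), hval]
    exact eq_comm
  · rw [LaverGraph, fInterp, dif_neg fun h => hx h.1]
    simp only [IsOrd, hx, false_and, not_false_eq_true, true_and, false_or]
    exact eq_comm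

theorem IsUplifting.exists_laver_eq {κ : Ordinal} (h : IsUplifting κ) (β θ : Ordinal) :
    ∃ γ, θ ≤ γ ∧ ExtAt κ γ ∧ laver κ γ = β := by
  by_contra! hc
  set η := max θ β
  have hcand : ∀ γ, OrdCand (laverBelow κ γ) η β := fun γ =>
    ⟨le_max_right _ _, fun m hm => le_of_not_gt fun hlt =>
      hc m ((le_max_left _ _).trans hlt.le) hm.2.1 hm.2.2⟩
  have hstage : ∀ γ, leastStage (laverBelow κ γ) ≤ η := fun γ => leastStage_le (hcand γ)
  have hmem : ∀ γ, OrdCand (laverBelow κ γ) (leastStage (laverBelow κ γ)) (laver κ γ) :=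
    fun γ => by
      rw [laver_eq]
      exact ordCand_leastValue (o := γ) fun m b hm => hm.1.le
  let S : Set Ordinal := {γ | η < γ ∧ ExtAt κ γ}
  have hlt : ∀ γ₁ ∈ S, ∀ γ₂ ∈ S, laver κ γ₁ = laver κ γ₂ → ¬ γ₁ < γ₂ := by
    intro γ₁ h₁ γ₂ h₂ heq hlt
    exact (((hmem γ₂).2 γ₁ ⟨hlt, h₁.2, heq⟩).trans (hstage γ₂)).not_gt h₁.1
  have hinj : Set.InjOn (laver κ) S := fun γ₁ h₁ γ₂ h₂ heq =>
    le_antisymm (not_lt.1 (hlt γ₂ h₂ γ₁ h₁ heq.symm)) (not_lt.1 (hlt γ₁ h₁ γ₂ h₂ heq))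
  let F : S → Set.Iic η := fun γ => ⟨laver κ γ.1, (hmem γ.1).1.trans (hstage γ.1)⟩
  have hF : Function.Injective F := fun γ₁ γ₂ heq =>
    Subtype.ext (hinj γ₁.2 γ₂.2 (congrArg Subtype.val heq))
  have : Small.{0} S := small_of_injective hF
  obtain ⟨b, hb⟩ := Ordinal.bddAbove_of_small (s := S)
  obtain ⟨γ, hγ, hle, hκ, hel⟩ := h.2 (Order.succ (max η b))
  have hlt' := Order.succ_le_iff.1 hle
  exact (hb ⟨(le_max_left _ _).trans_lt hlt', h.1, hγ, hκ, hel⟩).not_gt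
    ((le_max_right _ _).trans_lt hlt')

end Recursion

section Expansion

/-- The realization of a formula in `V_o` expanded by the anticipating function. -/
def LaverRealize (o : Ordinal) {m n : ℕ} (φ : LF.BoundedFormula (Fin m) n) (v : Fin m → Vt o)
    (w : Fin n → Vt o) : Prop :=
  letI := LFStructure o fun δ => laver δ o
  φ.Realize v w

/-- The value of a term in `V_o` expanded by the anticipating function. -/
noncomputable def laverTerm (o : Ordinal) {α : Type} (t : LF.Term α) (v : α → Vt o) : Vt o :=
  letI := LFStructure o fun δ => laver δ o
  t.realize v

theorem Dfn.laverTerm {α : Type} (t : LF.Term α) (ρ : α → ℕ) (k : ℕ) :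
    Dfn fun o s => laverTerm o t (fun i => s (ρ i)) = s k := by
  induction t generalizing ρ k with
  | var i => exact Dfn.eq (ρ i) k
  | func f ts ih =>
    cases f
    refine Dfn.congr (P := fun o s => ∃ a : Vt o,
      Paper.laverTerm o (ts 0) (fun i => s (ρ i)) = a ∧ LaverGraph a (s k)) ?_ ?_
    · exact .ex (.and (ih 0 (fun i => ρ i + 1) 0) (.laverGraph 0 (k + 1)))
    · intro o ho s
      simp only [exists_eq_left']
      exact (laverGraph_iff ho _ _).symm

theorem Dfn.laverRealize {m n : ℕ} (φ : LF.BoundedFormula (Fin m) n) (ρ : Fin m → ℕ)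
    (σ : Fin n → ℕ) :
    Dfn fun o s => LaverRealize o φ (fun i => s (ρ i)) (fun i => s (σ i)) := by
  have hterm : ∀ {n : ℕ} (t : LF.Term (Fin m ⊕ Fin n)) (ρ : Fin m → ℕ) (σ : Fin n → ℕ) (k : ℕ),
      Dfn fun o s => Paper.laverTerm o t (Sum.elim (fun i => s (ρ i)) (fun i => s (σ i))) = s k := by
    intro n t ρ σ k
    refine (Dfn.laverTerm t (Sum.elim ρ σ) k).congr fun o _ s => iff_of_eq ?_
    congr 2
    funext i
    cases i <;> rfl
  induction φ generalizing ρ with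
  | falsum => exact (Dfn.not (.eq 0 0)).congr fun o _ s => ⟨False.elim, fun h => (h rfl).elim⟩
  | equal t₁ t₂ =>
    refine (Dfn.ex (P := fun o s a =>
      Paper.laverTerm o t₁ (Sum.elim (fun i => s (ρ i)) (fun i => s (σ i))) = a ∧
      Paper.laverTerm o t₂ (Sum.elim (fun i => s (ρ i)) (fun i => s (σ i))) = a)
      (.and (hterm t₁ (fun i => ρ i + 1) (fun i => σ i + 1) 0)
        (hterm t₂ (fun i => ρ i + 1) (fun i => σ i + 1) 0))).congr fun o _ s => ?_
    simp only [exists_eq_left']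
    exact eq_comm
  | rel R ts =>
    cases R
    refine (Dfn.ex (P := fun o s a => ∃ b : Vt o,
      Paper.laverTerm o (ts 0) (Sum.elim (fun i => s (ρ i)) (fun i => s (σ i))) = a ∧
      Paper.laverTerm o (ts 1) (Sum.elim (fun i => s (ρ i)) (fun i => s (σ i))) = b ∧
      a.1 ∈ b.1)
      (.ex (.and (hterm (ts 0) (fun i => ρ i + 1 + 1) (fun i => σ i + 1 + 1) 1)
        (.and (hterm (ts 1) (fun i => ρ i + 1 + 1) (fun i => σ i + 1 + 1) 0)
          (.mem 1 0))))).congr fun o _ s => ?_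
    constructor
    · intro h
      exact ⟨_, _, rfl, rfl, h⟩
    · rintro ⟨_, _, rfl, rfl, h⟩
      exact h
  | imp _ _ ih₁ ih₂ => exact (ih₁ ρ σ).imp (ih₂ ρ σ)
  | all φ ih =>
    refine Dfn.all (P := fun o s a => LaverRealize o φ (fun i => s (ρ i))
      (Fin.snoc (fun i => s (σ i)) a)) ((ih (fun i => ρ i + 1)
        (Fin.snoc (α := fun _ => ℕ) (fun i => σ i + 1) 0)).congr fun o _ s => iff_of_eq ?_)
    congr 1
    funext i
    refine Fin.lastCases ?_ (fun i => ?_) i <;> simp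

/-- Elementary inclusions of limit levels preserve the anticipating function. -/
theorem VElem.fVElem {κ γ : Ordinal} (h : VElem κ γ) (hle : κ ≤ γ) (hκ : Order.IsSuccLimit κ)
    (hγ : Order.IsSuccLimit γ) :
    FVElem κ γ (fun δ => laver δ κ) (fun δ => laver δ γ) := by
  let _ := LFStructure κ fun δ => laver δ κ
  let _ := LFStructure γ fun δ => laver δ γ
  refine ⟨⟨incl hle, fun n φ x => ?_⟩, fun x => rfl⟩
  let s : ℕ → Vt κ := fun i => if hi : i < n then x ⟨i, hi⟩ else ⟨∅, by simpa using hκ.bot_lt⟩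
  have hs : (fun i : Fin n => s i) = x := by
    funext i
    simp [s]
  have key := h.iff_of_dfn hκ hγ (Dfn.laverRealize φ (fun i => i) Fin.elim0) s
    (fun i => incl hle (s i)) fun _ => rfl
  have h₁ : LaverRealize κ φ (fun i => s i) (fun i => s (Fin.elim0 i)) ↔ φ.Realize x := by
    rw [hs]
    exact iff_of_eq (congrArg (BoundedFormula.Realize φ x) (Subsingleton.elim _ _))
  have h₂ : LaverRealize γ φ (fun i => incl hle (s i)) (fun i => incl hle (s (Fin.elim0 i))) ↔
      φ.Realize (incl hle ∘ x) := by
    rw [← hs]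
    exact iff_of_eq (congrArg (BoundedFormula.Realize φ _) (Subsingleton.elim _ _))
  exact (h₁.symm.trans (key.trans h₂)).symm

end Expansion

/-- Every uplifting cardinal has an ordinal-anticipating uplifting Laver function. -/
theorem uplifting_has_ordinal_laver_function (κ : Ordinal) (h : IsUplifting κ) :
    ∃ ℓ : Ordinal → Ordinal, OrdLaverFor ℓ κ := by
  have hκ := h.1.isSuccLimit
  refine ⟨fun δ => laver δ κ, fun δ _ => laver_lt δ hκ.bot_lt, fun β θ => ?_⟩
  obtain ⟨γ, hθ, ⟨-, hγ, hlt, hel⟩, hβ⟩ := h.exists_laver_eq β θ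
  exact ⟨γ, fun δ => laver δ γ, hγ, hθ, hlt, fun δ _ => laver_lt δ hγ.isSuccLimit.bot_lt,
    hel.fVElem hlt.le hκ hγ.isSuccLimit, hβ⟩

end Paper
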